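/- arXiv:0909.5289 — 5 statements merged into one kernel-verified Lean document; each statement's English description precedes it below -/
import Mathlib

section
/- (Corollary 2) Let X = (X₁,…,X_p) be as in the Lévy–Khintchine setup, let β_r ∈ [0,∞) for r = 1,…,p, and assume P(X_r = 0) < 1 for each r = 1,…,p. Then E(∏_{r=1}^{p} |X_r|^{β_r}) < ∞ if and only if ∫_{ℝ^p} (∏_{r=1}^{p} |x_r|^{α_r}) dν₁(x) < ∞ for all α_r ∈ [0, β_r], r = 1,…,p. -/
open MeasureTheory ProbabilityTheory
open scoped RealInnerProductSpace

set_option linter.unusedSectionVars false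

namespace LevyKhintchine

open Filter Topology Complex
open scoped ENNReal NNReal

section Kernel

variable {E : Type*} [NormedAddCommGroup E] [InnerProductSpace ℝ E] [MeasurableSpace E]

/-- The integrand of the Lévy–Khintchine formula. -/
noncomputable def levyKernel (t x : E) : ℂ :=
  exp (I * ((⟪t, x⟫ : ℝ) : ℂ)) - 1 - I * ((⟪t, x⟫ : ℝ) : ℂ) / ((1 + ‖x‖ ^ 2 : ℝ) : ℂ)

/-- A Lévy measure has no atom at the origin and integrates `‖x‖² / (1 + ‖x‖²)`. -/
structure IsLevyMeasure (ν : Measure E) : Prop where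
  measure_zero : ν {0} = 0
  lintegral_lt_top : ∫⁻ x, ENNReal.ofReal (‖x‖ ^ 2 / (1 + ‖x‖ ^ 2)) ∂ν < ⊤

lemma norm_exp_I_mul_sub_one_sub_le (u : ℝ) :
    ‖exp (I * (u : ℂ)) - 1 - I * (u : ℂ)‖ ≤ 3 * u ^ 2 := by
  by_cases hu : |u| ≤ 1
  · have h := norm_exp_sub_one_sub_id_le (x := I * (u : ℂ)) (by simpa using hu)
    simp only [norm_mul, norm_I, one_mul, norm_real, Real.norm_eq_abs, sq_abs] at h
    nlinarith [sq_nonneg u]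
  · have h1 : ‖exp (I * (u : ℂ)) - 1‖ ≤ |u| := Real.norm_exp_I_mul_ofReal_sub_one_le
    have h2 : ‖I * (u : ℂ)‖ = |u| := by simp
    have h3 := norm_sub_le (exp (I * (u : ℂ)) - 1) (I * (u : ℂ))
    nlinarith [sq_abs u]

lemma norm_levyKernel_le (t x : E) :
    ‖levyKernel t x‖ ≤ (4 + ‖t‖ + 6 * ‖t‖ ^ 2) * (‖x‖ ^ 2 / (1 + ‖x‖ ^ 2)) := by
  have hu : |⟪t, x⟫| ≤ ‖t‖ * ‖x‖ := abs_real_inner_le_norm t x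
  set u : ℝ := ⟪t, x⟫ with hu_def
  have hT := norm_nonneg t
  have hN := norm_nonneg x
  have hD : 0 < 1 + ‖x‖ ^ 2 := by positivity
  rw [mul_div_assoc', le_div_iff₀ hD]
  rcases le_total ‖x‖ 1 with hx | hx
  · have h1 := norm_exp_I_mul_sub_one_sub_le u
    have heq : levyKernel t x = (exp (I * (u : ℂ)) - 1 - I * (u : ℂ))
        + I * ((u * (‖x‖ ^ 2 / (1 + ‖x‖ ^ 2)) : ℝ) : ℂ) := by
      have hD' : ((1 + ‖x‖ ^ 2 : ℝ) : ℂ) ≠ 0 := by exact_mod_cast hD.ne'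
      rw [levyKernel, ← hu_def]
      push_cast at hD' ⊢
      field_simp
      ring
    have h2 : ‖I * ((u * (‖x‖ ^ 2 / (1 + ‖x‖ ^ 2)) : ℝ) : ℂ)‖
        = |u| * (‖x‖ ^ 2 / (1 + ‖x‖ ^ 2)) := by
      rw [norm_mul, norm_I, one_mul, norm_real, Real.norm_eq_abs, abs_mul,
        abs_of_nonneg (by positivity : 0 ≤ ‖x‖ ^ 2 / (1 + ‖x‖ ^ 2))]
    have h3 := norm_add_le (exp (I * (u : ℂ)) - 1 - I * (u : ℂ))
      (I * ((u * (‖x‖ ^ 2 / (1 + ‖x‖ ^ 2)) : ℝ) : ℂ))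
    rw [← heq, h2] at h3
    have hu2 : u ^ 2 ≤ ‖t‖ ^ 2 * ‖x‖ ^ 2 := by
      rw [← sq_abs, ← mul_pow]; gcongr
    have hu3 : |u| ≤ ‖t‖ := hu.trans (mul_le_of_le_one_right hT hx)
    have hx2 : ‖x‖ ^ 2 ≤ 1 := pow_le_one₀ hN hx
    calc ‖levyKernel t x‖ * (1 + ‖x‖ ^ 2)
        ≤ (3 * (‖t‖ ^ 2 * ‖x‖ ^ 2) + ‖t‖ * (‖x‖ ^ 2 / (1 + ‖x‖ ^ 2))) * (1 + ‖x‖ ^ 2) := by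
          gcongr
          refine h3.trans (add_le_add (h1.trans (by linarith)) ?_)
          gcongr
      _ = 3 * (‖t‖ ^ 2 * ‖x‖ ^ 2) * (1 + ‖x‖ ^ 2) + ‖t‖ * ‖x‖ ^ 2 := by field_simp
      _ ≤ 3 * (‖t‖ ^ 2 * ‖x‖ ^ 2) * 2 + ‖t‖ * ‖x‖ ^ 2 := by gcongr; linarith
      _ ≤ _ := by nlinarith [sq_nonneg ‖x‖]
  · have h1 : ‖exp (I * (u : ℂ)) - 1‖ ≤ 2 := by
      refine (norm_sub_le _ _).trans ?_
      rw [mul_comm, norm_exp_ofReal_mul_I]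
      norm_num
    have h2 : ‖I * (u : ℂ) / ((1 + ‖x‖ ^ 2 : ℝ) : ℂ)‖ = |u| / (1 + ‖x‖ ^ 2) := by
      rw [norm_div, norm_mul, norm_I, one_mul, norm_real, norm_real, Real.norm_eq_abs,
        Real.norm_eq_abs, abs_of_pos hD]
    have h3 := norm_sub_le (exp (I * (u : ℂ)) - 1) (I * (u : ℂ) / ((1 + ‖x‖ ^ 2 : ℝ) : ℂ))
    rw [h2] at h3
    have hx2 : ‖x‖ ≤ ‖x‖ ^ 2 := by nlinarith
    calc ‖levyKernel t x‖ * (1 + ‖x‖ ^ 2)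
        ≤ (2 + |u| / (1 + ‖x‖ ^ 2)) * (1 + ‖x‖ ^ 2) := by
          gcongr
          exact h3.trans (by gcongr)
      _ = 2 * (1 + ‖x‖ ^ 2) + |u| := by field_simp
      _ ≤ 2 * (‖x‖ ^ 2 + ‖x‖ ^ 2) + ‖t‖ * ‖x‖ ^ 2 := by
          gcongr
          · nlinarith
          · exact hu.trans (by gcongr)
      _ ≤ _ := by nlinarith [mul_nonneg (sq_nonneg ‖t‖) (sq_nonneg ‖x‖)]

variable [BorelSpace E]

lemma continuous_levyKernel_right (t : E) : Continuous (levyKernel t) := by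
  unfold levyKernel
  refine Continuous.sub (by fun_prop) (Continuous.div (by fun_prop) (by fun_prop) fun x => ?_)
  exact_mod_cast (by positivity : (0 : ℝ) < 1 + ‖x‖ ^ 2).ne'

lemma continuous_levyKernel_left (x : E) : Continuous (fun t => levyKernel t x) := by
  unfold levyKernel
  fun_prop

variable {ν ν' : Measure E}

lemma continuous_sq_div : Continuous fun x : E => ‖x‖ ^ 2 / (1 + ‖x‖ ^ 2) :=
  Continuous.div (by fun_prop) (by fun_prop) fun x => by positivity

lemma IsLevyMeasure.integrable_sq_div (hν : IsLevyMeasure ν) :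
    Integrable (fun x => ‖x‖ ^ 2 / (1 + ‖x‖ ^ 2)) ν :=
  ⟨continuous_sq_div.aestronglyMeasurable, by
    rw [hasFiniteIntegral_iff_ofReal (.of_forall fun x => by positivity)]
    exact hν.lintegral_lt_top⟩

lemma IsLevyMeasure.integrable_levyKernel (hν : IsLevyMeasure ν) (t : E) :
    Integrable (levyKernel t) ν :=
  (hν.integrable_sq_div.const_mul _).mono' (continuous_levyKernel_right t).aestronglyMeasurable
    (.of_forall fun x => norm_levyKernel_le t x)

lemma IsLevyMeasure.mono (hν : IsLevyMeasure ν) (h : ν' ≤ ν) : IsLevyMeasure ν' where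
  measure_zero := le_antisymm ((h _).trans_eq hν.measure_zero) zero_le
  lintegral_lt_top := (lintegral_mono' h le_rfl).trans_lt hν.lintegral_lt_top

lemma IsLevyMeasure.add (hν : IsLevyMeasure ν) (hν' : IsLevyMeasure ν') :
    IsLevyMeasure (ν + ν') where
  measure_zero := by simp [hν.measure_zero, hν'.measure_zero]
  lintegral_lt_top := by
    rw [lintegral_add_measure]
    exact ENNReal.add_lt_top.2 ⟨hν.lintegral_lt_top, hν'.lintegral_lt_top⟩

lemma IsLevyMeasure.smul (hν : IsLevyMeasure ν) (c : ℝ≥0) : IsLevyMeasure (c • ν) where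
  measure_zero := by simp [hν.measure_zero]
  lintegral_lt_top := by
    rw [lintegral_smul_measure]
    exact ENNReal.mul_lt_top ENNReal.coe_lt_top hν.lintegral_lt_top

/-- A Lévy measure is finite away from the origin. -/
lemma IsLevyMeasure.measure_le_norm_lt_top (hν : IsLevyMeasure ν) {δ : ℝ} (hδ : 0 < δ) :
    ν {x | δ ≤ ‖x‖} < ⊤ := by
  have hc : 0 < δ ^ 2 / (1 + δ ^ 2) := by positivity
  refine (measure_mono ?_).trans_lt (hν.integrable_sq_div.measure_ge_lt_top hc)
  intro x (hx : δ ≤ ‖x‖)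
  show δ ^ 2 / (1 + δ ^ 2) ≤ ‖x‖ ^ 2 / (1 + ‖x‖ ^ 2)
  rw [div_le_div_iff₀ (by positivity) (by positivity)]
  nlinarith [mul_self_le_mul_self hδ.le hx]

lemma IsLevyMeasure.isFiniteMeasure_restrict (hν : IsLevyMeasure ν) {δ : ℝ} (hδ : 0 < δ) :
    IsFiniteMeasure (ν.restrict {x | δ ≤ ‖x‖}) :=
  ⟨by simpa using hν.measure_le_norm_lt_top hδ⟩

/-- The drift compensating a finite Lévy measure. -/
noncomputable def drift (ν : Measure E) : E := ∫ x, (1 + ‖x‖ ^ 2)⁻¹ • x ∂ν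

lemma norm_inv_smul_le (x : E) : ‖(1 + ‖x‖ ^ 2)⁻¹ • x‖ ≤ 1 := by
  rw [norm_smul, Real.norm_eq_abs, abs_of_nonneg (by positivity), inv_mul_le_one₀ (by positivity)]
  nlinarith [sq_nonneg (‖x‖ - 1)]

variable [SecondCountableTopology E]

lemma integrable_inv_smul (ρ : Measure E) [IsFiniteMeasure ρ] :
    Integrable (fun x : E => (1 + ‖x‖ ^ 2)⁻¹ • x) ρ := by
  refine Integrable.of_bound (C := 1) (Continuous.aestronglyMeasurable ?_)
    (.of_forall norm_inv_smul_le)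
  exact Continuous.smul (Continuous.inv₀ (by fun_prop) fun x => by positivity) continuous_id

lemma inner_drift [CompleteSpace E] (ρ : Measure E) [IsFiniteMeasure ρ] (t : E) :
    ⟪t, drift ρ⟫ = ∫ x, ⟪t, x⟫ / (1 + ‖x‖ ^ 2) ∂ρ := by
  rw [drift, ← integral_inner (integrable_inv_smul ρ)]
  congr 1 with x
  rw [real_inner_smul_right]; ring

lemma IsLevyMeasure.tendsto_integral_restrict {F : Type*} [NormedAddCommGroup F] [NormedSpace ℝ F]
    (hν : IsLevyMeasure ν) {f : E → F} (hf : Integrable f ν) :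
    Tendsto (fun n : ℕ => ∫ x, f x ∂(ν.restrict {x | 1 / ((n : ℝ) + 1) ≤ ‖x‖})) atTop
      (𝓝 (∫ x, f x ∂ν)) := by
  have hU : (⋃ n : ℕ, {x : E | 1 / ((n : ℝ) + 1) ≤ ‖x‖}) = {0}ᶜ := by
    ext x
    simp only [Set.mem_iUnion, Set.mem_ofPred_eq, Set.mem_compl_iff, Set.mem_singleton_iff]
    constructor
    · rintro ⟨n, hn⟩ rfl
      rw [norm_zero] at hn
      exact absurd hn (not_le.2 Nat.one_div_pos_of_nat)
    · intro hx
      obtain ⟨n, hn⟩ := exists_nat_one_div_lt (norm_pos_iff.2 hx)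
      exact ⟨n, hn.le⟩
  have h := tendsto_setIntegral_of_monotone (μ := ν) (f := f)
    (s := fun n : ℕ => {x : E | 1 / ((n : ℝ) + 1) ≤ ‖x‖})
    (fun n => (isClosed_le continuous_const continuous_norm).measurableSet)
    (fun m n hmn x (hx : _ ≤ ‖x‖) => (Nat.one_div_le_one_div hmn).trans hx) hf.integrableOn
  rwa [hU, setIntegral_congr_set (t := Set.univ), setIntegral_univ] at h
  exact ae_eq_univ.2 (by simpa using hν.measure_zero)

end Kernel

section CompoundPoisson

variable {E : Type*} [NormedAddCommGroup E] [InnerProductSpace ℝ E] [MeasurableSpace E]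
  [BorelSpace E] [SecondCountableTopology E]

/-- The `n`-fold convolution power of a measure. -/
noncomputable def convPow (ρ : Measure E) : ℕ → Measure E
  | 0 => Measure.dirac 0
  | n + 1 => ρ ∗ convPow ρ n

instance isFiniteMeasure_convPow (ρ : Measure E) [IsFiniteMeasure ρ] (n : ℕ) :
    IsFiniteMeasure (convPow ρ n) := by
  induction n with
  | zero => unfold convPow; infer_instance
  | succ n ih => unfold convPow; infer_instance

lemma charFun_convPow (ρ : Measure E) [IsFiniteMeasure ρ] (n : ℕ) (t : E) :
    charFun (convPow ρ n) t = charFun ρ t ^ n := by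
  induction n with
  | zero => simp [convPow, charFun_dirac]
  | succ n ih => rw [convPow, charFun_conv, ih, pow_succ']

lemma lintegral_convPow_le (ρ : Measure E) [IsFiniteMeasure ρ] {f : E → ℝ≥0∞} (hf : Measurable f)
    (h0 : f 0 ≤ 1) (hmul : ∀ x y, f (x + y) ≤ f x * f y) (n : ℕ) :
    ∫⁻ x, f x ∂(convPow ρ n) ≤ (∫⁻ x, f x ∂ρ) ^ n := by
  induction n with
  | zero => simpa [convPow, lintegral_dirac' _ hf] using h0
  | succ n ih =>
    rw [convPow, Measure.lintegral_conv hf, pow_succ']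
    calc ∫⁻ x, ∫⁻ y, f (x + y) ∂(convPow ρ n) ∂ρ
        ≤ ∫⁻ x, ∫⁻ y, f x * f y ∂(convPow ρ n) ∂ρ :=
          lintegral_mono fun x => lintegral_mono fun y => hmul x y
      _ = (∫⁻ x, f x ∂ρ) * ∫⁻ y, f y ∂(convPow ρ n) := by
          simp_rw [lintegral_const_mul _ hf, lintegral_mul_const _ hf]
      _ ≤ _ := by gcongr

lemma measure_univ_convPow (ρ : Measure E) [IsFiniteMeasure ρ] (n : ℕ) :
    convPow ρ n Set.univ = ρ Set.univ ^ n := by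
  have h := charFun_convPow ρ n 0
  simp only [charFun_zero] at h
  rw [← ENNReal.ofReal_toReal (measure_ne_top (convPow ρ n) Set.univ),
    ← ENNReal.ofReal_toReal (measure_ne_top ρ Set.univ), ← ENNReal.ofReal_pow (by simp)]
  congr 1
  exact_mod_cast h

/-- The weight of `n` jumps of a compound Poisson law with Lévy measure `ρ`. -/
noncomputable def jumpWeight (ρ : Measure E) (n : ℕ) : ℝ :=
  Real.exp (-ρ.real Set.univ) * (n.factorial : ℝ)⁻¹

lemma jumpWeight_pos (ρ : Measure E) (n : ℕ) : 0 < jumpWeight ρ n := by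
  unfold jumpWeight; positivity

/-- The compound Poisson law with finite Lévy measure `ρ`. -/
noncomputable def compoundPoisson (ρ : Measure E) : Measure E :=
  Measure.sum fun n => ENNReal.ofReal (jumpWeight ρ n) • convPow ρ n

lemma tsum_jumpWeight_mul_pow (ρ : Measure E) {m : ℝ} (hm : 0 ≤ m) :
    ∑' n, ENNReal.ofReal (jumpWeight ρ n) * ENNReal.ofReal m ^ n
      = ENNReal.ofReal (Real.exp (m - ρ.real Set.univ)) := by
  have hs : HasSum (fun n => jumpWeight ρ n * m ^ n) (Real.exp (m - ρ.real Set.univ)) := by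
    have h := (NormedSpace.expSeries_div_hasSum_exp (𝔸 := ℝ) m).mul_left
      (Real.exp (-ρ.real Set.univ))
    rw [← Real.exp_eq_exp_ℝ, ← Real.exp_add] at h
    rw [sub_eq_neg_add]
    simpa only [jumpWeight, div_eq_inv_mul, mul_assoc] using h
  rw [← hs.tsum_eq, ENNReal.ofReal_tsum_of_nonneg _ hs.summable]
  · congr 1 with n
    rw [ENNReal.ofReal_mul (jumpWeight_pos ρ n).le, ENNReal.ofReal_pow hm]
  · exact fun n => mul_nonneg (jumpWeight_pos ρ n).le (pow_nonneg hm n)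

lemma lintegral_compoundPoisson_le (ρ : Measure E) [IsFiniteMeasure ρ] {f : E → ℝ≥0∞}
    (hf : Measurable f) (h0 : f 0 ≤ 1) (hmul : ∀ x y, f (x + y) ≤ f x * f y)
    (hfin : ∫⁻ x, f x ∂ρ ≠ ⊤) :
    ∫⁻ x, f x ∂(compoundPoisson ρ)
      ≤ ENNReal.ofReal (Real.exp ((∫⁻ x, f x ∂ρ).toReal - ρ.real Set.univ)) := by
  rw [compoundPoisson, lintegral_sum_measure, ← tsum_jumpWeight_mul_pow ρ ENNReal.toReal_nonneg]
  refine ENNReal.tsum_le_tsum fun n => ?_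
  rw [lintegral_smul_measure, ENNReal.ofReal_toReal hfin, smul_eq_mul]
  gcongr
  exact lintegral_convPow_le ρ hf h0 hmul n

instance isProbabilityMeasure_compoundPoisson (ρ : Measure E) [IsFiniteMeasure ρ] :
    IsProbabilityMeasure (compoundPoisson ρ) := by
  constructor
  have h := tsum_jumpWeight_mul_pow ρ (m := ρ.real Set.univ) measureReal_nonneg
  rw [sub_self, Real.exp_zero, ENNReal.ofReal_one] at h
  rw [compoundPoisson, Measure.sum_apply _ MeasurableSet.univ, ← h]
  congr 1 with n
  rw [Measure.smul_apply, measure_univ_convPow, smul_eq_mul, Measure.real,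
    ENNReal.ofReal_toReal (measure_ne_top _ _)]

lemma le_compoundPoisson (ρ : Measure E) [IsFiniteMeasure ρ] :
    ENNReal.ofReal (jumpWeight ρ 1) • ρ ≤ compoundPoisson ρ := by
  have h := Measure.le_sum (fun n => ENNReal.ofReal (jumpWeight ρ n) • convPow ρ n) 1
  simpa [convPow, compoundPoisson] using h

lemma integrable_exp_inner (μ : Measure E) [IsFiniteMeasure μ] (t : E) :
    Integrable (fun x => exp ((⟪x, t⟫ : ℝ) * I)) μ :=
  Integrable.of_bound (C := 1) (by fun_prop) (.of_forall fun x => by simp [norm_exp_ofReal_mul_I])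

lemma charFun_compoundPoisson (ρ : Measure E) [IsFiniteMeasure ρ] (t : E) :
    charFun (compoundPoisson ρ) t = exp (charFun ρ t - (ρ.real Set.univ : ℂ)) := by
  have hinteg := integrable_exp_inner (compoundPoisson ρ) t
  have h1 : charFun (compoundPoisson ρ) t
      = ∑' n, ((jumpWeight ρ n : ℝ) : ℂ) * charFun ρ t ^ n := by
    rw [charFun_apply, compoundPoisson, integral_sum_measure hinteg]
    congr 1 with n
    rw [integral_smul_measure, ← charFun_apply, charFun_convPow,
      ENNReal.toReal_ofReal (jumpWeight_pos ρ n).le, real_smul]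
  have h := (NormedSpace.expSeries_div_hasSum_exp (𝔸 := ℂ) (charFun ρ t)).mul_left
    (exp (-(ρ.real Set.univ : ℂ)))
  rw [← Complex.exp_eq_exp_ℂ, ← Complex.exp_add] at h
  rw [h1, sub_eq_neg_add, ← h.tsum_eq]
  congr 1 with n
  unfold jumpWeight
  push_cast
  ring

end CompoundPoisson

section Triplet

variable {p : ℕ}

/-- The Lévy–Khintchine exponent with drift `a`, Gaussian covariance `A` and Lévy measure `ν`. -/
noncomputable def levyExponent (a : EuclideanSpace ℝ (Fin p)) (A : Matrix (Fin p) (Fin p) ℝ)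
    (ν : Measure (EuclideanSpace ℝ (Fin p))) (t : EuclideanSpace ℝ (Fin p)) : ℂ :=
  I * ((⟪a, t⟫ : ℝ) : ℂ) - ((∑ i, ∑ j, A i j * t i * t j : ℝ) : ℂ) / 2 + ∫ x, levyKernel t x ∂ν

/-- The measure `μ` has the Lévy–Khintchine characteristic function with triplet `(a, A, ν)`. -/
def HasLevyTriplet (μ : Measure (EuclideanSpace ℝ (Fin p))) (a : EuclideanSpace ℝ (Fin p))
    (A : Matrix (Fin p) (Fin p) ℝ) (ν : Measure (EuclideanSpace ℝ (Fin p))) : Prop :=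
  ∀ t, charFun μ t = exp (levyExponent a A ν t)

variable {a a' : EuclideanSpace ℝ (Fin p)} {A A' : Matrix (Fin p) (Fin p) ℝ}
  {ν ν' μ μ' : Measure (EuclideanSpace ℝ (Fin p))}

lemma levyExponent_add (hν : IsLevyMeasure ν) (hν' : IsLevyMeasure ν')
    (t : EuclideanSpace ℝ (Fin p)) :
    levyExponent (a + a') (A + A') (ν + ν') t = levyExponent a A ν t + levyExponent a' A' ν' t := by
  unfold levyExponent
  rw [integral_add_measure (hν.integrable_levyKernel t) (hν'.integrable_levyKernel t),
    inner_add_left]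
  simp only [Matrix.add_apply, add_mul, Finset.sum_add_distrib, ofReal_add]
  ring

lemma levyExponent_smul (c : ℝ≥0) (t : EuclideanSpace ℝ (Fin p)) :
    levyExponent ((c : ℝ) • a) ((c : ℝ) • A) (c • ν) t = (c : ℂ) * levyExponent a A ν t := by
  unfold levyExponent
  rw [integral_smul_nnreal_measure, real_inner_smul_left]
  have h : ∑ i, ∑ j, ((c : ℝ) • A) i j * t i * t j = c * ∑ i, ∑ j, A i j * t i * t j := by
    simp only [Matrix.smul_apply, smul_eq_mul, Finset.mul_sum, mul_assoc]
  rw [h, NNReal.smul_def, real_smul]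
  push_cast
  ring

lemma HasLevyTriplet.conv [IsFiniteMeasure μ] [IsFiniteMeasure μ']
    (h : HasLevyTriplet μ a A ν) (h' : HasLevyTriplet μ' a' A' ν')
    (hν : IsLevyMeasure ν) (hν' : IsLevyMeasure ν') :
    HasLevyTriplet (μ ∗ μ') (a + a') (A + A') (ν + ν') := fun t => by
  rw [charFun_conv, h t, h' t, levyExponent_add hν hν', exp_add]

lemma HasLevyTriplet.unique [IsFiniteMeasure μ] [IsFiniteMeasure μ']
    (h : HasLevyTriplet μ a A ν) (h' : HasLevyTriplet μ' a A ν) : μ = μ' :=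
  Measure.ext_of_charFun (funext fun t => (h t).trans (h' t).symm)

lemma hasLevyTriplet_compoundPoisson (ρ : Measure (EuclideanSpace ℝ (Fin p))) [IsFiniteMeasure ρ] :
    HasLevyTriplet (compoundPoisson ρ) (drift ρ) 0 ρ := fun t => by
  rw [charFun_compoundPoisson]
  congr 1
  have h1 : Integrable (fun x => exp (I * ((⟪t, x⟫ : ℝ) : ℂ))) ρ := by
    simpa only [mul_comm, real_inner_comm] using integrable_exp_inner ρ t
  have h2 : Integrable (fun x => I * ((⟪t, x⟫ : ℝ) : ℂ) / ((1 + ‖x‖ ^ 2 : ℝ) : ℂ)) ρ := by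
    have h := (((integrable_inv_smul ρ).const_inner (𝕜 := ℝ) t).ofReal (𝕜 := ℂ)).const_mul I
    refine h.congr (.of_forall fun x => ?_)
    simp only [real_inner_smul_right, coe_algebraMap]
    push_cast
    ring
  have h3 : ∫ x, I * ((⟪t, x⟫ : ℝ) : ℂ) / ((1 + ‖x‖ ^ 2 : ℝ) : ℂ) ∂ρ
      = I * ((⟪t, drift ρ⟫ : ℝ) : ℂ) := by
    rw [inner_drift, ← integral_complex_ofReal, ← integral_const_mul]
    congr 1 with x
    push_cast
    ring
  have h4 : charFun ρ t = ∫ x, exp (I * ((⟪t, x⟫ : ℝ) : ℂ)) ∂ρ := by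
    rw [charFun_apply]
    congr 1 with x
    rw [mul_comm, real_inner_comm]
  have h5 : ∫ x, levyKernel t x ∂ρ = charFun ρ t - (ρ.real Set.univ : ℂ)
      - I * ((⟪t, drift ρ⟫ : ℝ) : ℂ) := by
    rw [h4, ← h3]
    have h6 := integral_sub (h1.sub (integrable_const (1 : ℂ))) h2
    have h7 := integral_sub h1 (integrable_const (1 : ℂ))
    simp only [Pi.sub_apply] at h6
    rw [h7] at h6
    simpa [levyKernel] using h6
  rw [levyExponent, h5, real_inner_comm]
  simp

lemma hasLevyTriplet_dirac (b : EuclideanSpace ℝ (Fin p)) :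
    HasLevyTriplet (Measure.dirac b) b 0 0 := fun t => by
  rw [charFun_dirac]
  simp [levyExponent, mul_comm]

lemma hasLevyTriplet_multivariateGaussian (a : EuclideanSpace ℝ (Fin p)) (hA : A.PosSemidef) :
    HasLevyTriplet (multivariateGaussian a A) a A 0 := fun t => by
  rw [charFun_multivariateGaussian hA, levyExponent, integral_zero_measure, add_zero,
    real_inner_comm, mul_comm]
  congr 4
  simp only [dotProduct, Matrix.mulVec, Finset.mul_sum]
  refine Finset.sum_congr rfl fun i _ => Finset.sum_congr rfl fun j _ => by ring

lemma isLevyMeasure_zero : IsLevyMeasure (0 : Measure (EuclideanSpace ℝ (Fin p))) := ⟨by simp, by simp⟩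

/-- The law with triplet `(a, A, ρ)` for a finite Lévy measure `ρ`. -/
noncomputable def finiteLevyLaw (a : EuclideanSpace ℝ (Fin p)) (A : Matrix (Fin p) (Fin p) ℝ)
    (ρ : Measure (EuclideanSpace ℝ (Fin p))) : Measure (EuclideanSpace ℝ (Fin p)) :=
  multivariateGaussian a A ∗ (Measure.dirac (-drift ρ) ∗ compoundPoisson ρ)

instance isProbabilityMeasure_finiteLevyLaw (ρ : Measure (EuclideanSpace ℝ (Fin p)))
    [IsFiniteMeasure ρ] : IsProbabilityMeasure (finiteLevyLaw a A ρ) := by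
  unfold finiteLevyLaw; infer_instance

lemma hasLevyTriplet_finiteLevyLaw (hA : A.PosSemidef) [IsFiniteMeasure ν]
    (hν : IsLevyMeasure ν) : HasLevyTriplet (finiteLevyLaw a A ν) a A ν := by
  have h := (hasLevyTriplet_multivariateGaussian a hA).conv
    ((hasLevyTriplet_dirac (-drift ν)).conv (hasLevyTriplet_compoundPoisson ν)
      isLevyMeasure_zero hν) isLevyMeasure_zero (isLevyMeasure_zero.add hν)
  simpa [finiteLevyLaw] using h

lemma continuous_levyExponent (hν : IsLevyMeasure ν) : Continuous (levyExponent a A ν) := by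
  unfold levyExponent
  refine Continuous.add (by fun_prop) (continuous_iff_continuousAt.2 fun t₀ => ?_)
  refine continuousAt_of_dominated
    (bound := fun x => (4 + (‖t₀‖ + 1) + 6 * (‖t₀‖ + 1) ^ 2) * (‖x‖ ^ 2 / (1 + ‖x‖ ^ 2)))
    (.of_forall fun t => (continuous_levyKernel_right t).aestronglyMeasurable) ?_
    (hν.integrable_sq_div.const_mul _)
    (.of_forall fun x => (continuous_levyKernel_left x).continuousAt)
  have hnear : ∀ᶠ t in 𝓝 t₀, ‖t‖ < ‖t₀‖ + 1 :=
    continuous_norm.continuousAt.eventually_lt continuousAt_const (by simp)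
  filter_upwards [hnear] with t ht
  refine .of_forall fun x => (norm_levyKernel_le t x).trans ?_
  gcongr

lemma tendsto_levyExponent_restrict (hν : IsLevyMeasure ν) (t : EuclideanSpace ℝ (Fin p)) :
    Tendsto (fun n : ℕ => levyExponent a A (ν.restrict {x | 1 / ((n : ℝ) + 1) ≤ ‖x‖}) t) atTop
      (𝓝 (levyExponent a A ν t)) :=
  (hν.tendsto_integral_restrict (hν.integrable_levyKernel t)).const_add _

lemma tendsto_charFun_finiteLevyLaw (hA : A.PosSemidef) (hν : IsLevyMeasure ν)
    (t : EuclideanSpace ℝ (Fin p)) :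
    Tendsto (fun n : ℕ =>
      charFun (finiteLevyLaw a A (ν.restrict {x | 1 / ((n : ℝ) + 1) ≤ ‖x‖})) t) atTop
      (𝓝 (exp (levyExponent a A ν t))) := by
  have h (n : ℕ) : charFun (finiteLevyLaw a A (ν.restrict {x | 1 / ((n : ℝ) + 1) ≤ ‖x‖})) t
      = exp (levyExponent a A (ν.restrict {x | 1 / ((n : ℝ) + 1) ≤ ‖x‖}) t) :=
    have := hν.isFiniteMeasure_restrict (Nat.one_div_pos_of_nat (α := ℝ) (n := n))
    hasLevyTriplet_finiteLevyLaw hA (hν.mono Measure.restrict_le_self) t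
  simp_rw [h]
  exact (continuous_exp.tendsto _).comp (tendsto_levyExponent_restrict hν t)

/-- Every Lévy triplet is the triplet of a probability measure. -/
theorem exists_hasLevyTriplet (a : EuclideanSpace ℝ (Fin p)) (hA : A.PosSemidef)
    (hν : IsLevyMeasure ν) :
    ∃ μ : Measure (EuclideanSpace ℝ (Fin p)), IsProbabilityMeasure μ ∧ HasLevyTriplet μ a A ν := by
  have hfin (n : ℕ) := hν.isFiniteMeasure_restrict (Nat.one_div_pos_of_nat (α := ℝ) (n := n))
  let μs (n : ℕ) : ProbabilityMeasure (EuclideanSpace ℝ (Fin p)) :=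
    ⟨finiteLevyLaw a A (ν.restrict {x | 1 / ((n : ℝ) + 1) ≤ ‖x‖}), inferInstance⟩
  have hlim (t : EuclideanSpace ℝ (Fin p)) : Tendsto (fun n => charFun (μs n) t) atTop
      (𝓝 (exp (levyExponent a A ν t))) := tendsto_charFun_finiteLevyLaw hA hν t
  have htight := isTightMeasureSet_of_tendsto_charFun (μ := fun n => (μs n : Measure _))
    (continuous_exp.comp (continuous_levyExponent (a := a) (A := A) hν)).continuousAt hlim
  have hcomp : IsCompact (closure (Set.range μs)) :=
    isCompact_closure_of_isTightMeasureSet (by simpa [Set.range] using htight)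
  obtain ⟨μ, -, hμ⟩ := hcomp.exists_mapClusterPt_of_frequently (l := atTop) (f := μs)
    (Frequently.of_forall fun n => subset_closure ⟨n, rfl⟩)
  refine ⟨μ, inferInstance, fun t => ?_⟩
  have hcont : Continuous fun ρ : ProbabilityMeasure (EuclideanSpace ℝ (Fin p)) =>
      charFun (ρ : Measure _) t := by
    refine continuous_iff_continuousAt.2 fun ρ => ?_
    simp_rw [ContinuousAt, charFun_eq_integral_innerProbChar]
    exact (ProbabilityMeasure.tendsto_iff_forall_integral_rclike_tendsto ℂ).1 tendsto_id
      (BoundedContinuousFunction.innerProbChar t)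
  obtain ⟨ψ, hψ, hψlim⟩ := (hμ.continuousAt_comp hcont.continuousAt).tendsto_subseq
  exact tendsto_nhds_unique hψlim ((hlim t).comp hψ.tendsto_atTop)

end Triplet

section ExponentialMoments

variable {p : ℕ} {a : EuclideanSpace ℝ (Fin p)} {A : Matrix (Fin p) (Fin p) ℝ}
  {ν μ ρ : Measure (EuclideanSpace ℝ (Fin p))}

lemma exp_sub_one_sub_le (u : ℝ) : Real.exp u - 1 - u ≤ u ^ 2 * Real.exp |u| := by
  have h := norm_exp_sub_sum_le_norm_mul_exp (u : ℂ) 2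
  simp only [Finset.sum_range_succ, Finset.sum_range_zero, norm_real, Real.norm_eq_abs, sq_abs] at h
  refine (le_abs_self _).trans (le_of_eq_of_le ?_ h)
  rw [← Real.norm_eq_abs, ← norm_real]
  congr 1
  push_cast
  simp
  ring

/-- The Laplace exponent integrand is of second order on bounded sets. -/
lemma exp_inner_sub_one_le {E : Type*} [NormedAddCommGroup E] [InnerProductSpace ℝ E]
    (s : E) {x : E} {τ : ℝ} (hx : ‖x‖ ≤ τ) :
    Real.exp ⟪s, x⟫ - 1 ≤ ⟪s, x⟫ / (1 + ‖x‖ ^ 2)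
      + (‖s‖ ^ 2 * Real.exp (‖s‖ * τ) * (1 + τ ^ 2) + ‖s‖ * τ) * (‖x‖ ^ 2 / (1 + ‖x‖ ^ 2)) := by
  have hu : |⟪s, x⟫| ≤ ‖s‖ * ‖x‖ := abs_real_inner_le_norm s x
  have hu' : |⟪s, x⟫| ≤ ‖s‖ * τ := hu.trans (by gcongr)
  have hs := norm_nonneg s
  have hx0 := norm_nonneg x
  set u : ℝ := ⟪s, x⟫
  have hD : 0 < 1 + ‖x‖ ^ 2 := by positivity
  have h1 : u ^ 2 * Real.exp |u| ≤ ‖s‖ ^ 2 * ‖x‖ ^ 2 * Real.exp (‖s‖ * τ) := by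
    rw [← sq_abs u, ← mul_pow]
    gcongr
  have h2 : ‖s‖ ^ 2 * ‖x‖ ^ 2 * Real.exp (‖s‖ * τ)
      ≤ ‖s‖ ^ 2 * Real.exp (‖s‖ * τ) * (1 + τ ^ 2) * (‖x‖ ^ 2 / (1 + ‖x‖ ^ 2)) := by
    have h : ‖x‖ ^ 2 ≤ (1 + τ ^ 2) * (‖x‖ ^ 2 / (1 + ‖x‖ ^ 2)) := by
      rw [mul_div_assoc', le_div_iff₀ hD]
      have : ‖x‖ ^ 2 ≤ τ ^ 2 := by gcongr
      nlinarith [sq_nonneg ‖x‖]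
    calc _ = ‖s‖ ^ 2 * Real.exp (‖s‖ * τ) * ‖x‖ ^ 2 := by ring
      _ ≤ ‖s‖ ^ 2 * Real.exp (‖s‖ * τ) * ((1 + τ ^ 2) * (‖x‖ ^ 2 / (1 + ‖x‖ ^ 2))) := by gcongr
      _ = _ := by ring
  have h3 : u = u / (1 + ‖x‖ ^ 2) + u * (‖x‖ ^ 2 / (1 + ‖x‖ ^ 2)) := by field_simp
  have h4 : u * (‖x‖ ^ 2 / (1 + ‖x‖ ^ 2)) ≤ ‖s‖ * τ * (‖x‖ ^ 2 / (1 + ‖x‖ ^ 2)) := by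
    gcongr
    exact (le_abs_self u).trans hu'
  have h5 := exp_sub_one_sub_le u
  rw [add_mul]
  linarith

lemma measurable_ofReal_exp_inner (s : EuclideanSpace ℝ (Fin p)) :
    Measurable fun x : EuclideanSpace ℝ (Fin p) => ENNReal.ofReal (Real.exp ⟪s, x⟫) := by
  fun_prop

lemma ofReal_exp_inner_add (s x y : EuclideanSpace ℝ (Fin p)) :
    ENNReal.ofReal (Real.exp ⟪s, x + y⟫)
      = ENNReal.ofReal (Real.exp ⟪s, x⟫) * ENNReal.ofReal (Real.exp ⟪s, y⟫) := by
  rw [inner_add_right, Real.exp_add, ENNReal.ofReal_mul (Real.exp_pos _).le]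

lemma lintegral_exp_inner_conv (s : EuclideanSpace ℝ (Fin p)) [SFinite ρ] :
    ∫⁻ x, ENNReal.ofReal (Real.exp ⟪s, x⟫) ∂(μ ∗ ρ)
      = (∫⁻ x, ENNReal.ofReal (Real.exp ⟪s, x⟫) ∂μ)
        * ∫⁻ x, ENNReal.ofReal (Real.exp ⟪s, x⟫) ∂ρ := by
  rw [Measure.lintegral_conv (measurable_ofReal_exp_inner s)]
  simp_rw [ofReal_exp_inner_add]
  simp_rw [lintegral_const_mul _ (measurable_ofReal_exp_inner s)]
  rw [lintegral_mul_const _ (measurable_ofReal_exp_inner s)]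

lemma lintegral_exp_inner_gaussian_lt_top [IsGaussian μ] (s : EuclideanSpace ℝ (Fin p)) :
    ∫⁻ x, ENNReal.ofReal (Real.exp ⟪s, x⟫) ∂μ < ⊤ := by
  have h := IsGaussian.map_eq_gaussianReal (μ := μ) (innerSL ℝ s)
  have h1 := integrable_exp_mul_gaussianReal (μ := μ[innerSL ℝ s])
    (v := (Var[innerSL ℝ s; μ]).toNNReal) 1
  rw [← h, integrable_map_measure (by fun_prop) (by fun_prop)] at h1
  have h2 := h1.lintegral_lt_top
  simpa using h2

/-- Uniform exponential moment bound for compensated compound Poisson laws with bounded jumps. -/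
lemma lintegral_exp_inner_compensated_le [IsFiniteMeasure ρ] {τ : ℝ}
    (hτ : ∀ᵐ x ∂ρ, ‖x‖ ≤ τ) (s : EuclideanSpace ℝ (Fin p)) :
    ∫⁻ x, ENNReal.ofReal (Real.exp ⟪s, x⟫) ∂(Measure.dirac (-drift ρ) ∗ compoundPoisson ρ)
      ≤ ENNReal.ofReal (Real.exp
        ((‖s‖ ^ 2 * Real.exp (‖s‖ * τ) * (1 + τ ^ 2) + ‖s‖ * τ)
          * ∫ x, ‖x‖ ^ 2 / (1 + ‖x‖ ^ 2) ∂ρ)) := by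
  set C := ‖s‖ ^ 2 * Real.exp (‖s‖ * τ) * (1 + τ ^ 2) + ‖s‖ * τ
  have hinteg : Integrable (fun x => Real.exp ⟪s, x⟫) ρ := by
    refine Integrable.of_bound (C := Real.exp (‖s‖ * τ)) (by fun_prop) ?_
    filter_upwards [hτ] with x hx
    rw [Real.norm_eq_abs, Real.abs_exp]
    gcongr
    exact (real_inner_le_norm s x).trans (by gcongr)
  have hfin : ∫⁻ x, ENNReal.ofReal (Real.exp ⟪s, x⟫) ∂ρ ≠ ⊤ := hinteg.lintegral_lt_top.ne
  have hM : (∫⁻ x, ENNReal.ofReal (Real.exp ⟪s, x⟫) ∂ρ).toReal = ∫ x, Real.exp ⟪s, x⟫ ∂ρ :=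
    (integral_eq_lintegral_of_nonneg_ae (.of_forall fun x => (Real.exp_pos _).le) (by fun_prop)).symm
  have hq : Integrable (fun x => ‖x‖ ^ 2 / (1 + ‖x‖ ^ 2)) ρ := by
    refine Integrable.of_bound (C := 1) continuous_sq_div.aestronglyMeasurable
      (.of_forall fun x => ?_)
    rw [Real.norm_eq_abs, abs_of_nonneg (by positivity), div_le_one (by positivity)]
    linarith
  have hd : Integrable (fun x => ⟪s, x⟫ / (1 + ‖x‖ ^ 2)) ρ := by
    refine ((integrable_inv_smul ρ).const_inner (𝕜 := ℝ) s).congr (.of_forall fun x => ?_)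
    simp only [real_inner_smul_right]
    ring
  have hle : (∫ x, Real.exp ⟪s, x⟫ ∂ρ) - ρ.real Set.univ
      ≤ ⟪s, drift ρ⟫ + C * ∫ x, ‖x‖ ^ 2 / (1 + ‖x‖ ^ 2) ∂ρ := by
    rw [inner_drift, ← integral_const_mul, ← integral_add hd (hq.const_mul C)]
    have h1 : (∫ x, Real.exp ⟪s, x⟫ ∂ρ) - ρ.real Set.univ = ∫ x, (Real.exp ⟪s, x⟫ - 1) ∂ρ := by
      rw [integral_sub hinteg (integrable_const _)]; simp
    rw [h1]
    refine integral_mono_ae (hinteg.sub (integrable_const _)) (hd.add (hq.const_mul C)) ?_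
    filter_upwards [hτ] with x hx using exp_inner_sub_one_le s hx
  rw [lintegral_exp_inner_conv, lintegral_dirac' _ (measurable_ofReal_exp_inner s)]
  calc _ ≤ ENNReal.ofReal (Real.exp ⟪s, -drift ρ⟫) * ENNReal.ofReal (Real.exp
        ((∫⁻ x, ENNReal.ofReal (Real.exp ⟪s, x⟫) ∂ρ).toReal - ρ.real Set.univ)) := by
        gcongr
        exact lintegral_compoundPoisson_le ρ (measurable_ofReal_exp_inner s) (by simp)
          (fun x y => (ofReal_exp_inner_add s x y).le) hfin
    _ ≤ _ := by
        rw [← ENNReal.ofReal_mul (Real.exp_pos _).le, ← Real.exp_add, hM, inner_neg_right]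
        gcongr
        linarith

/-- A law whose Lévy measure has bounded support has all exponential moments. -/
theorem HasLevyTriplet.lintegral_exp_inner_lt_top [IsProbabilityMeasure μ]
    (h : HasLevyTriplet μ a A ν) (hA : A.PosSemidef) (hν : IsLevyMeasure ν) {τ : ℝ}
    (hτ0 : 0 ≤ τ) (hτ : ∀ᵐ x ∂ν, ‖x‖ ≤ τ) (s : EuclideanSpace ℝ (Fin p)) :
    ∫⁻ x, ENNReal.ofReal (Real.exp ⟪s, x⟫) ∂μ < ⊤ := by
  have hfin (n : ℕ) := hν.isFiniteMeasure_restrict (Nat.one_div_pos_of_nat (α := ℝ) (n := n))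
  let μs (n : ℕ) : ProbabilityMeasure (EuclideanSpace ℝ (Fin p)) :=
    ⟨finiteLevyLaw a A (ν.restrict {x | 1 / ((n : ℝ) + 1) ≤ ‖x‖}), inferInstance⟩
  have hlim : Tendsto μs atTop (𝓝 ⟨μ, inferInstance⟩) := by
    refine ProbabilityMeasure.tendsto_iff_tendsto_charFun.2 fun t => ?_
    have := tendsto_charFun_finiteLevyLaw (a := a) hA hν t
    rwa [← h t] at this
  have hF := lintegral_le_liminf_lintegral_of_forall_isOpen_measure_le_liminf_measure
    (μ := μ) (μs := fun n => (μs n : Measure (EuclideanSpace ℝ (Fin p))))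
    (f := fun x => Real.exp ⟪s, x⟫) (by fun_prop) (fun x => (Real.exp_pos _).le)
    (fun G hG => ProbabilityMeasure.le_liminf_measure_open_of_tendsto hlim hG)
  set C := ‖s‖ ^ 2 * Real.exp (‖s‖ * τ) * (1 + τ ^ 2) + ‖s‖ * τ
  have hC : 0 ≤ C := by positivity
  let K := (∫⁻ x, ENNReal.ofReal (Real.exp ⟪s, x⟫) ∂(multivariateGaussian a A))
    * ENNReal.ofReal (Real.exp (C * ∫ x, ‖x‖ ^ 2 / (1 + ‖x‖ ^ 2) ∂ν))
  have hK : K < ⊤ :=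
    ENNReal.mul_lt_top (lintegral_exp_inner_gaussian_lt_top s) ENNReal.ofReal_lt_top
  refine hF.trans_lt (lt_of_le_of_lt ?_ hK)
  refine (liminf_le_liminf (v := fun _ => K) (.of_forall fun n => ?_)).trans (liminf_const K).le
  show ∫⁻ x, ENNReal.ofReal (Real.exp ⟪s, x⟫)
    ∂(finiteLevyLaw a A (ν.restrict {x | 1 / ((n : ℝ) + 1) ≤ ‖x‖})) ≤ K
  rw [finiteLevyLaw, lintegral_exp_inner_conv]
  refine mul_le_mul' le_rfl ?_
  refine (lintegral_exp_inner_compensated_le (ae_restrict_of_ae hτ) s).trans ?_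
  refine ENNReal.ofReal_le_ofReal (Real.exp_le_exp.2 (mul_le_mul_of_nonneg_left ?_ hC))
  exact setIntegral_le_integral hν.integrable_sq_div (.of_forall fun x => by positivity)

/-- A submultiplicative weight comparable to `∏ r, max 1 |x r| ^ β r`. -/
noncomputable def growth (β : Fin p → ℝ) (x : EuclideanSpace ℝ (Fin p)) : ℝ :=
  ∏ r, (1 + |x r|) ^ β r

lemma measurable_growth (β : Fin p → ℝ) : Measurable (growth β) := by
  unfold growth; fun_prop

lemma growth_nonneg (β : Fin p → ℝ) (x : EuclideanSpace ℝ (Fin p)) : 0 ≤ growth β x :=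
  Finset.prod_nonneg fun _ _ => by positivity

lemma growth_zero (β : Fin p → ℝ) : growth β 0 = 1 := by simp [growth]

lemma growth_add_le {β : Fin p → ℝ} (hβ : ∀ r, 0 ≤ β r) (x y : EuclideanSpace ℝ (Fin p)) :
    growth β (x + y) ≤ growth β x * growth β y := by
  unfold growth
  rw [← Finset.prod_mul_distrib]
  refine Finset.prod_le_prod (fun r _ => by positivity) fun r _ => ?_
  rw [← Real.mul_rpow (by positivity) (by positivity)]
  refine Real.rpow_le_rpow (by positivity) ?_ (hβ r)
  have h : |(x + y) r| ≤ |x r| + |y r| := abs_add_le (x r) (y r)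
  nlinarith [mul_nonneg (abs_nonneg (x r)) (abs_nonneg (y r))]

lemma growth_le_sum_exp {β : Fin p → ℝ} (hβ : ∀ r, 0 ≤ β r) (x : EuclideanSpace ℝ (Fin p)) :
    growth β x ≤ ∑ σ ∈ Fintype.piFinset fun _ : Fin p => ({1, -1} : Finset ℝ),
      Real.exp ⟪WithLp.toLp 2 (fun r => σ r * β r), x⟫ := by
  have h1 : growth β x
      ≤ ∏ r, ∑ j ∈ ({1, -1} : Finset ℝ), Real.exp (x r * (j * β r)) := by
    refine Finset.prod_le_prod (fun r _ => by positivity) fun r _ => ?_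
    rw [Finset.sum_pair (by norm_num)]
    have h2 : (1 + |x r|) ^ β r ≤ Real.exp (|x r| * β r) := by
      rw [Real.exp_mul]
      refine Real.rpow_le_rpow (by positivity) ?_ (hβ r)
      linarith [Real.add_one_le_exp |x r|]
    refine h2.trans ?_
    rcases abs_choice (x r) with h | h <;> rw [h] <;> ring_nf <;>
      linarith [Real.exp_pos (x r * β r), Real.exp_pos (-(x r * β r))]
  rw [Finset.prod_univ_sum] at h1
  refine h1.trans_eq (Finset.sum_congr rfl fun σ _ => ?_)
  rw [← Real.exp_sum]
  simp [PiLp.inner_apply]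

lemma HasLevyTriplet.lintegral_growth_lt_top [IsProbabilityMeasure μ]
    (h : HasLevyTriplet μ a A ν) (hA : A.PosSemidef) (hν : IsLevyMeasure ν) {τ : ℝ}
    (hτ0 : 0 ≤ τ) (hτ : ∀ᵐ x ∂ν, ‖x‖ ≤ τ) {β : Fin p → ℝ} (hβ : ∀ r, 0 ≤ β r) :
    ∫⁻ x, ENNReal.ofReal (growth β x) ∂μ < ⊤ := by
  calc _ ≤ ∫⁻ x, ∑ σ ∈ Fintype.piFinset fun _ : Fin p => ({1, -1} : Finset ℝ),
        ENNReal.ofReal (Real.exp ⟪WithLp.toLp 2 (fun r => σ r * β r), x⟫) ∂μ := by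
        refine lintegral_mono fun x => ?_
        rw [← ENNReal.ofReal_sum_of_nonneg fun _ _ => (Real.exp_pos _).le]
        exact ENNReal.ofReal_le_ofReal (growth_le_sum_exp hβ x)
    _ < ⊤ := by
        rw [lintegral_finsetSum _ fun σ _ => measurable_ofReal_exp_inner _]
        exact ENNReal.sum_lt_top.2 fun σ _ => h.lintegral_exp_inner_lt_top hA hν hτ0 hτ _

end ExponentialMoments

section Sufficiency

variable {p : ℕ} {a : EuclideanSpace ℝ (Fin p)} {A : Matrix (Fin p) (Fin p) ℝ}
  {ν μ ρ : Measure (EuclideanSpace ℝ (Fin p))}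

/-- A finite part of the Lévy measure can be split off as a compound Poisson factor. -/
lemma HasLevyTriplet.exists_conv_compoundPoisson [IsProbabilityMeasure μ] [IsFiniteMeasure ρ]
    (h : HasLevyTriplet μ a A (ν + ρ)) (hA : A.PosSemidef) (hν : IsLevyMeasure ν)
    (hρ : IsLevyMeasure ρ) :
    ∃ η : Measure (EuclideanSpace ℝ (Fin p)), IsProbabilityMeasure η ∧
      HasLevyTriplet η (a - drift ρ) A ν ∧ μ = η ∗ compoundPoisson ρ := by
  obtain ⟨η, hη, hηT⟩ := exists_hasLevyTriplet (a - drift ρ) hA hν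
  refine ⟨η, hη, hηT, h.unique ?_⟩
  simpa using hηT.conv (hasLevyTriplet_compoundPoisson ρ) hν hρ

lemma growth_le_sum_prod {β : Fin p → ℝ} (hβ : ∀ r, 0 ≤ β r) (x : EuclideanSpace ℝ (Fin p)) :
    growth β x ≤ (∏ r, (2 : ℝ) ^ β r) *
      ∑ σ ∈ Fintype.piFinset fun _ : Fin p => ({0, 1} : Finset ℝ), ∏ r, |x r| ^ (σ r * β r) := by
  rw [← Finset.prod_univ_sum (fun _ : Fin p => ({0, 1} : Finset ℝ)) (fun r j => |x r| ^ (j * β r)),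
    ← Finset.prod_mul_distrib]
  refine Finset.prod_le_prod (fun r _ => by positivity) fun r _ => ?_
  rw [Finset.sum_pair (by norm_num), zero_mul, one_mul, Real.rpow_zero]
  have hx := abs_nonneg (x r)
  have h1 : 0 ≤ |x r| ^ β r := by positivity
  have h2 : (0 : ℝ) < 2 ^ β r := by positivity
  rcases le_total |x r| 1 with h | h
  · calc (1 + |x r|) ^ β r ≤ 2 ^ β r := Real.rpow_le_rpow (by positivity) (by linarith) (hβ r)
      _ ≤ _ := le_mul_of_one_le_right h2.le (by linarith)
  · calc (1 + |x r|) ^ β r ≤ (2 * |x r|) ^ β r :=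
        Real.rpow_le_rpow (by positivity) (by linarith) (hβ r)
      _ = 2 ^ β r * |x r| ^ β r := Real.mul_rpow (by norm_num) hx
      _ ≤ _ := by gcongr; linarith

lemma lintegral_growth_lt_top_of_forall {β : Fin p → ℝ} (hβ : ∀ r, 0 ≤ β r)
    (h : ∀ α : Fin p → ℝ, (∀ r, α r ∈ Set.Icc 0 (β r)) →
      ∫⁻ x, ENNReal.ofReal (∏ r, |x r| ^ α r) ∂ρ < ⊤) :
    ∫⁻ x, ENNReal.ofReal (growth β x) ∂ρ < ⊤ := by
  have hK : 0 ≤ ∏ r, (2 : ℝ) ^ β r := Finset.prod_nonneg fun _ _ => by positivity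
  have hnn (σ : Fin p → ℝ) (x : EuclideanSpace ℝ (Fin p)) : 0 ≤ ∏ r, |x r| ^ (σ r * β r) :=
    Finset.prod_nonneg fun _ _ => by positivity
  calc _ ≤ ∫⁻ x, ENNReal.ofReal (∏ r, (2 : ℝ) ^ β r)
        * ∑ σ ∈ Fintype.piFinset fun _ : Fin p => ({0, 1} : Finset ℝ),
          ENNReal.ofReal (∏ r, |x r| ^ (σ r * β r)) ∂ρ := by
        refine lintegral_mono fun x => ?_
        rw [← ENNReal.ofReal_sum_of_nonneg fun σ _ => hnn σ x, ← ENNReal.ofReal_mul hK]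
        exact ENNReal.ofReal_le_ofReal (growth_le_sum_prod hβ x)
    _ < ⊤ := by
        rw [lintegral_const_mul _ (by fun_prop), lintegral_finsetSum _ fun σ _ => by fun_prop]
        refine ENNReal.mul_lt_top ENNReal.ofReal_lt_top (ENNReal.sum_lt_top.2 fun σ hσ => h _ ?_)
        intro r
        have hr := Fintype.mem_piFinset.1 hσ r
        simp only [Finset.mem_insert, Finset.mem_singleton] at hr
        rcases hr with hr | hr <;> simp [hr, hβ r]

lemma restrict_lt_add_restrict_le (ν : Measure (EuclideanSpace ℝ (Fin p))) (τ : ℝ) :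
    ν.restrict {x | ‖x‖ < τ} + ν.restrict {x | τ ≤ ‖x‖} = ν := by
  have h : MeasurableSet {x : EuclideanSpace ℝ (Fin p) | ‖x‖ < τ} :=
    measurableSet_lt measurable_norm measurable_const
  have h2 : {x : EuclideanSpace ℝ (Fin p) | τ ≤ ‖x‖} = {x | ‖x‖ < τ}ᶜ := by ext; simp
  rw [h2, Measure.restrict_add_restrict_compl h]

/-- Finite mixed moments of the large jumps give finite mixed moments of the law. -/
theorem HasLevyTriplet.lintegral_prod_lt_top [IsProbabilityMeasure μ]
    (h : HasLevyTriplet μ a A ν) (hA : A.PosSemidef) (hν : IsLevyMeasure ν) {τ : ℝ} (hτ : 0 < τ)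
    {β : Fin p → ℝ} (hβ : ∀ r, 0 ≤ β r)
    (hfin : ∀ α : Fin p → ℝ, (∀ r, α r ∈ Set.Icc 0 (β r)) →
      ∫⁻ x, ENNReal.ofReal (∏ r, |x r| ^ α r) ∂(ν.restrict {x | τ ≤ ‖x‖}) < ⊤) :
    ∫⁻ x, ENNReal.ofReal (∏ r, |x r| ^ β r) ∂μ < ⊤ := by
  have := hν.isFiniteMeasure_restrict hτ
  have hs := hν.mono (Measure.restrict_le_self (s := {x | ‖x‖ < τ}))
  rw [← restrict_lt_add_restrict_le ν τ] at h
  obtain ⟨η, hη, hηT, rfl⟩ := h.exists_conv_compoundPoisson hA hs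
    (hν.mono Measure.restrict_le_self)
  have hg : Measurable fun x => ENNReal.ofReal (growth β x) := (measurable_growth β).ennreal_ofReal
  have hmul (x y : EuclideanSpace ℝ (Fin p)) : ENNReal.ofReal (growth β (x + y))
      ≤ ENNReal.ofReal (growth β x) * ENNReal.ofReal (growth β y) := by
    rw [← ENNReal.ofReal_mul (growth_nonneg β x)]
    exact ENNReal.ofReal_le_ofReal (growth_add_le hβ x y)
  have hcp := (lintegral_compoundPoisson_le _ hg (by simp [growth_zero]) hmul
    (lintegral_growth_lt_top_of_forall hβ hfin).ne).trans_lt ENNReal.ofReal_lt_top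
  have hY := hηT.lintegral_growth_lt_top hA hs hτ.le
    (ae_restrict_of_forall_mem (measurableSet_lt measurable_norm measurable_const)
      fun x (hx : ‖x‖ < τ) => hx.le) hβ
  calc _ ≤ ∫⁻ x, ENNReal.ofReal (growth β x) ∂(η ∗ compoundPoisson (ν.restrict {x | τ ≤ ‖x‖})) := by
        refine lintegral_mono fun x => ENNReal.ofReal_le_ofReal ?_
        exact Finset.prod_le_prod (fun r _ => by positivity) fun r _ =>
          Real.rpow_le_rpow (by positivity) (by linarith) (hβ r)
    _ ≤ ∫⁻ x, ∫⁻ y, ENNReal.ofReal (growth β x) * ENNReal.ofReal (growth β y)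
          ∂(compoundPoisson (ν.restrict {x | τ ≤ ‖x‖})) ∂η := by
        rw [Measure.lintegral_conv hg]
        exact lintegral_mono fun x => lintegral_mono fun y => hmul x y
    _ < ⊤ := by
        simp_rw [lintegral_const_mul _ hg]
        rw [lintegral_mul_const _ hg]
        exact ENNReal.mul_lt_top hY hcp

end Sufficiency

section ConvSupport

variable {E : Type*} [NormedAddCommGroup E] [InnerProductSpace ℝ E] [MeasurableSpace E]
  [BorelSpace E] [SecondCountableTopology E] {μ π : Measure E}

lemma add_mem_support_conv {η : Measure E} [IsFiniteMeasure μ] [IsFiniteMeasure η] {u v : E}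
    (hu : u ∈ μ.support) (hv : v ∈ η.support) : u + v ∈ (μ ∗ η).support := by
  rw [Measure.mem_support_iff_forall] at *
  intro U hU
  have hadd : Tendsto (fun q : E × E => q.1 + q.2) (𝓝 u ×ˢ 𝓝 v) (𝓝 (u + v)) := by
    rw [← nhds_prod_eq]; exact tendsto_add
  obtain ⟨U₁, hU₁, U₂, hU₂, hsub⟩ := mem_prod_iff.1 (hadd hU)
  calc 0 < μ U₁ * η U₂ := ENNReal.mul_pos (hu U₁ hU₁).ne' (hv U₂ hU₂).ne'
    _ = (μ.prod η) (U₁ ×ˢ U₂) := (Measure.prod_prod _ _).symm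
    _ ≤ (μ.prod η) ((fun q : E × E => q.1 + q.2) ⁻¹' U) := measure_mono hsub
    _ ≤ (μ ∗ η) U := Measure.le_map_apply (by fun_prop) U

lemma nsmul_mem_support_convPow [IsFiniteMeasure π] {x : E} (hx : x ∈ π.support) (n : ℕ) :
    n • x ∈ (convPow π n).support := by
  induction n with
  | zero =>
    rw [zero_smul, Measure.mem_support_iff_forall]
    intro U hU
    rw [convPow, Measure.dirac_apply_of_mem (mem_of_mem_nhds hU)]
    exact one_pos
  | succ n ih =>
    rw [succ_nsmul', convPow]
    exact add_mem_support_conv hx ih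

lemma convPow_add [CompleteSpace E] [IsFiniteMeasure π] (m n : ℕ) :
    convPow π (m + n) = convPow π m ∗ convPow π n :=
  Measure.ext_of_charFun (funext fun t => by
    rw [charFun_conv, charFun_convPow, charFun_convPow, charFun_convPow, pow_add])

lemma nsmul_add_nsmul_mem_support_convPow [CompleteSpace E] [IsFiniteMeasure π] {x y : E}
    (hx : x ∈ π.support) (hy : y ∈ π.support) (m n : ℕ) :
    m • x + n • y ∈ (convPow π (m + n)).support := by
  rw [convPow_add]
  exact add_mem_support_conv (nsmul_mem_support_convPow hx m) (nsmul_mem_support_convPow hy n)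

lemma support_subset_closure {s : Set E} (hs : ∀ᵐ x ∂μ, x ∈ s) : μ.support ⊆ closure s := by
  intro x hx
  rw [Measure.mem_support_iff_forall] at hx
  refine mem_closure_iff_nhds.2 fun U hU => ?_
  by_contra hne
  refine (hx U hU).ne' (measure_mono_null ?_ (ae_iff.1 hs))
  exact fun y hy hys => hne ⟨y, hy, hys⟩

end ConvSupport

section Nondegenerate

variable {p : ℕ} {a : EuclideanSpace ℝ (Fin p)} {A : Matrix (Fin p) (Fin p) ℝ}
  {ν μ : Measure (EuclideanSpace ℝ (Fin p))}

/-- The `r`-th marginal of a law with Gaussian covariance `A` and Lévy measure `ν` is not a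
point mass. -/
def IsNondegenerate (A : Matrix (Fin p) (Fin p) ℝ) (ν : Measure (EuclideanSpace ℝ (Fin p)))
    (r : Fin p) : Prop :=
  A r r ≠ 0 ∨ ν {x | x r ≠ 0} ≠ 0

lemma levyExponent_single (r : Fin p) (θ : ℝ) :
    levyExponent a A ν (EuclideanSpace.single r θ) = I * ((a r * θ : ℝ) : ℂ)
      - ((A r r * θ ^ 2 : ℝ) : ℂ) / 2 + ∫ x, levyKernel (EuclideanSpace.single r θ) x ∂ν := by
  have h : ∑ i, ∑ j, A i j * EuclideanSpace.single r θ i * EuclideanSpace.single r θ j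
      = A r r * θ ^ 2 := by
    simp
    ring
  rw [levyExponent, h, EuclideanSpace.inner_single_right]
  simp [mul_comm]

lemma re_levyKernel_single (r : Fin p) (θ : ℝ) (x : EuclideanSpace ℝ (Fin p)) :
    (levyKernel (EuclideanSpace.single r θ) x).re = Real.cos (θ * x r) - 1 := by
  have h : I * ((θ * x r : ℝ) : ℂ) / ((1 + ‖x‖ ^ 2 : ℝ) : ℂ)
      = I * ((θ * x r / (1 + ‖x‖ ^ 2) : ℝ) : ℂ) := by push_cast; ring
  have h' : (⟪EuclideanSpace.single r θ, x⟫ : ℝ) = θ * x r := by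
    rw [EuclideanSpace.inner_single_left]; simp
  rw [levyKernel, h', h, mul_comm I, mul_comm I]
  rw [sub_re, sub_re, exp_ofReal_mul_I_re, re_ofReal_mul, I_re, one_re, mul_zero, sub_zero]

lemma charFun_single (r : Fin p) (θ : ℝ) :
    charFun μ (EuclideanSpace.single r θ)
      = ∫ x : EuclideanSpace ℝ (Fin p), exp (((x r * θ : ℝ) : ℂ) * I) ∂μ := by
  rw [charFun_apply]
  congr 1 with x
  rw [EuclideanSpace.inner_single_right]
  simp [mul_comm]

/-- A marginal which is almost surely constant is degenerate. -/
lemma HasLevyTriplet.not_isNondegenerate [IsProbabilityMeasure μ] (h : HasLevyTriplet μ a A ν)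
    (hA : A.PosSemidef) (hν : IsLevyMeasure ν) {r : Fin p} {c : ℝ} (hc : ∀ᵐ x ∂μ, x r = c) :
    ¬ IsNondegenerate A ν r := by
  have hre (θ : ℝ) : -(A r r * θ ^ 2) / 2 + ∫ x, (Real.cos (θ * x r) - 1) ∂ν = 0 := by
    have h1 : charFun μ (EuclideanSpace.single r θ) = exp (((c * θ : ℝ) : ℂ) * I) := by
      rw [charFun_single, integral_congr_ae (g := fun _ => exp (((c * θ : ℝ) : ℂ) * I))]
      · simp
      · filter_upwards [hc] with x hx
        rw [hx]
    have h2 := congrArg norm ((h _).symm.trans h1)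
    rw [norm_exp_ofReal_mul_I, norm_exp, Real.exp_eq_one_iff, levyExponent_single] at h2
    have h3 : (∫ x, levyKernel (EuclideanSpace.single r θ) x ∂ν).re
        = ∫ x, (Real.cos (θ * x r) - 1) ∂ν := by
      simp_rw [← re_levyKernel_single]
      exact (integral_re (hν.integrable_levyKernel _)).symm
    rw [add_re, h3, sub_re, mul_comm I, re_ofReal_mul, I_re, div_ofNat_re, ofReal_re] at h2
    linarith
  have hinteg (θ : ℝ) : Integrable (fun x : EuclideanSpace ℝ (Fin p) => Real.cos (θ * x r) - 1) ν := by
    simp_rw [← re_levyKernel_single]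
    exact (hν.integrable_levyKernel _).re
  have hneg (θ : ℝ) : ∫ x, (Real.cos (θ * x r) - 1) ∂ν ≤ 0 :=
    integral_nonpos fun x => by simpa using Real.cos_le_one _
  have hdiag : 0 ≤ A r r := hA.diag_nonneg
  have hzero : A r r = 0 := by
    have h1 := hre 1
    have h2 := hneg 1
    linarith
  have hcos (n : ℕ) : ∀ᵐ x ∂ν, Real.cos (1 / ((n : ℝ) + 1) * x r) = 1 := by
    have h1 := hre (1 / ((n : ℝ) + 1))
    rw [hzero, zero_mul, neg_zero, zero_div, zero_add] at h1
    have h2 : ∫ x, (1 - Real.cos (1 / ((n : ℝ) + 1) * x r)) ∂ν = 0 := by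
      rw [← neg_eq_zero, ← integral_neg, ← h1]
      congr 1 with x
      ring
    rw [integral_eq_zero_iff_of_nonneg (fun x => by simpa using Real.cos_le_one _)
      ((hinteg (1 / ((n : ℝ) + 1))).neg.congr (.of_forall fun x => by simp))] at h2
    filter_upwards [h2] with x hx
    simp only [Pi.zero_apply] at hx
    linarith
  rintro (h1 | h1)
  · exact h1 hzero
  · refine h1 ?_
    have h2 : ∀ᵐ x ∂ν, x r = 0 := by
      filter_upwards [ae_all_iff.2 hcos] with x hx
      obtain ⟨n, hn⟩ := exists_nat_gt |x r|
      have hn' : 0 < (n : ℝ) + 1 := by positivity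
      have h3 : |1 / ((n : ℝ) + 1) * x r| < 1 := by
        rw [abs_mul, abs_of_pos (by positivity), one_div, inv_mul_lt_one₀ hn']
        linarith
      have hpi := Real.pi_gt_three
      rw [abs_lt] at h3
      have h4 := (Real.cos_eq_one_iff_of_lt_of_lt (by linarith) (by linarith)).1 (hx n)
      simpa [hn'.ne'] using h4
    exact ae_iff.1 h2

/-- A degenerate marginal is almost surely equal to the drift. -/
lemma HasLevyTriplet.ae_eq_of_not_isNondegenerate [IsProbabilityMeasure μ]
    (h : HasLevyTriplet μ a A ν) {r : Fin p} (hr : ¬ IsNondegenerate A ν r) :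
    ∀ᵐ x ∂μ, x r = a r := by
  simp only [IsNondegenerate, not_or, not_not] at hr
  have hx : ∀ᵐ x ∂ν, x r = 0 := ae_iff.2 hr.2
  have hm : Measurable fun x : EuclideanSpace ℝ (Fin p) => x r := by fun_prop
  have := Measure.isProbabilityMeasure_map (μ := μ) hm.aemeasurable
  have hmap : μ.map (fun x => x r) = Measure.dirac (a r) := by
    refine Measure.ext_of_charFun (funext fun θ => ?_)
    have h1 : ∫ x, levyKernel (EuclideanSpace.single r θ) x ∂ν = 0 := by
      refine integral_eq_zero_of_ae ?_
      filter_upwards [hx] with x hx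
      simp [levyKernel, EuclideanSpace.inner_single_left, hx]
    have h2 := h (EuclideanSpace.single r θ)
    rw [levyExponent_single, h1, hr.1, charFun_single] at h2
    rw [charFun_apply, integral_map hm.aemeasurable (by fun_prop), charFun_dirac]
    simpa [mul_comm] using h2
  have h3 : ∀ᵐ y ∂(μ.map fun x => x r), y = a r := by
    rw [hmap]; exact (ae_dirac_iff (measurableSet_singleton (a r))).2 rfl
  exact ae_of_ae_map hm.aemeasurable h3

lemma HasLevyTriplet.exists_mem_support_ne [IsProbabilityMeasure μ] (h : HasLevyTriplet μ a A ν)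
    (hA : A.PosSemidef) (hν : IsLevyMeasure ν) {r : Fin p} (hr : IsNondegenerate A ν r) :
    ∃ u ∈ μ.support, ∃ v ∈ μ.support, u r ≠ v r := by
  by_contra! hcon
  obtain ⟨u, hu⟩ := nonempty_of_mem (Measure.support_mem_ae (μ := μ))
  refine h.not_isNondegenerate hA hν (c := u r) ?_ hr
  filter_upwards [Measure.support_mem_ae (μ := μ)] with v hv using (hcon u hu v hv).symm

/-- Laws with a Lévy triplet have convolution roots of all orders. -/
lemma HasLevyTriplet.exists_root [IsProbabilityMeasure μ] (h : HasLevyTriplet μ a A ν)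
    (hA : A.PosSemidef) (hν : IsLevyMeasure ν) (n : ℕ) :
    ∃ (c : ℝ≥0) (π : Measure (EuclideanSpace ℝ (Fin p))), c ≠ 0 ∧ IsProbabilityMeasure π ∧
      HasLevyTriplet π ((c : ℝ) • a) ((c : ℝ) • A) (c • ν) ∧ μ = convPow π (n + 1) := by
  let c : ℝ≥0 := ((n : ℝ≥0) + 1)⁻¹
  obtain ⟨π, hπ, hT⟩ := exists_hasLevyTriplet ((c : ℝ) • a) (hA.smul c.coe_nonneg) (hν.smul c)
  refine ⟨c, π, by positivity, hπ, hT, Measure.ext_of_charFun (funext fun t => ?_)⟩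
  rw [charFun_convPow, h t, hT t, levyExponent_smul, ← exp_nat_mul, ← mul_assoc]
  have h1 : (((n + 1 : ℕ) : ℂ)) * (c : ℂ) = 1 := by
    have : ((n : ℂ) + 1) ≠ 0 := by exact_mod_cast n.succ_ne_zero
    simp [c, this]
  rw [h1, one_mul]

lemma IsNondegenerate.smul {r : Fin p} (hr : IsNondegenerate A ν r) {c : ℝ≥0} (hc : c ≠ 0) :
    IsNondegenerate ((c : ℝ) • A) (c • ν) r := by
  refine hr.imp (fun h => ?_) (fun h => ?_)
  · simpa [hc] using h
  · simpa [hc] using h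

end Nondegenerate

section Necessity

variable {p : ℕ} {a : EuclideanSpace ℝ (Fin p)} {A : Matrix (Fin p) (Fin p) ℝ}
  {ν μ ρ : Measure (EuclideanSpace ℝ (Fin p))}

/-- If each of `p` obstructions excludes at most one of `p + 1` choices, some choice is free. -/
lemma exists_forall_not {bad : Fin (p + 1) → Fin p → Prop}
    (h : ∀ r i j, bad i r → bad j r → i = j) : ∃ i, ∀ r, ¬ bad i r := by
  by_contra! hcon
  choose f hf using hcon
  obtain ⟨i, j, hij, hf'⟩ := Fintype.exists_ne_map_eq_of_card_lt f (by simp)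
  exact hij (h (f i) i j (hf i) (hf' ▸ hf j))

/-- Two points of the support differ in all nondegenerate coordinates simultaneously. -/
lemma HasLevyTriplet.exists_mem_support_forall_ne [IsProbabilityMeasure μ]
    (h : HasLevyTriplet μ a A ν) (hA : A.PosSemidef) (hν : IsLevyMeasure ν) (S : Finset (Fin p))
    (hS : ∀ r ∈ S, IsNondegenerate A ν r) :
    ∃ u ∈ μ.support, ∃ v ∈ μ.support, ∀ r ∈ S, u r ≠ v r := by
  induction S using Finset.induction_on generalizing μ a A ν with
  | empty =>
    obtain ⟨u, hu⟩ := nonempty_of_mem (Measure.support_mem_ae (μ := μ))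
    exact ⟨u, hu, u, hu, by simp⟩
  | insert r₀ S _ ih =>
    obtain ⟨c, π, hc, hπ, hT, rfl⟩ := h.exists_root hA hν p
    have hcA := hA.smul c.coe_nonneg
    obtain ⟨u, hu, v, hv, huv⟩ := ih hT hcA (hν.smul c)
      fun r hr => (hS r (Finset.mem_insert_of_mem hr)).smul hc
    obtain ⟨u', hu', v', hv', huv'⟩ := hT.exists_mem_support_ne hcA (hν.smul c)
      ((hS r₀ (Finset.mem_insert_self _ _)).smul hc)
    obtain ⟨k, hk⟩ := exists_forall_not (p := p) (bad := fun k r => r ∈ insert r₀ S ∧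
      (k : ℝ) * (v r - u r) + (v' r - u' r) = 0) fun r i j ⟨hr, hi⟩ ⟨_, hj⟩ => by
        have hd : v r - u r ≠ 0 := by
          intro hd
          rcases Finset.mem_insert.1 hr with rfl | hr
          · rw [hd] at hi
            exact huv' (by linarith)
          · exact huv r hr (by linarith)
        have hij : ((i : ℕ) : ℝ) = (j : ℕ) := mul_right_cancel₀ hd (by linarith)
        exact Fin.ext (by exact_mod_cast hij)
    refine ⟨p • u + 1 • u', nsmul_add_nsmul_mem_support_convPow hu hu' p 1,
      (k : ℕ) • v + (p - k) • u + 1 • v', ?_, fun r hr heq => hk r ⟨hr, ?_⟩⟩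
    · have hkp : convPow π (p + 1) = convPow π ((k : ℕ) + (p - k) + 1) := by congr 1; omega
      rw [hkp, convPow_add]
      exact add_mem_support_conv (nsmul_add_nsmul_mem_support_convPow hv hu _ _)
        (nsmul_mem_support_convPow hv' 1)
    · simp only [PiLp.add_apply, PiLp.smul_apply, nsmul_eq_mul, Nat.cast_one, one_mul,
        Nat.cast_sub (Nat.lt_succ_iff.1 k.2)] at heq
      linarith

/-- The support contains `p + 1` points with pairwise distinct nondegenerate coordinates. -/
lemma HasLevyTriplet.exists_family_mem_support [IsProbabilityMeasure μ]
    (h : HasLevyTriplet μ a A ν) (hA : A.PosSemidef) (hν : IsLevyMeasure ν) :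
    ∃ w : Fin (p + 1) → EuclideanSpace ℝ (Fin p), (∀ j, w j ∈ μ.support) ∧
      ∀ r, IsNondegenerate A ν r → ∀ i j, i ≠ j → w i r ≠ w j r := by
  classical
  obtain ⟨c, π, hc, hπ, hT, rfl⟩ := h.exists_root hA hν p
  obtain ⟨u, hu, v, hv, huv⟩ := hT.exists_mem_support_forall_ne (hA.smul c.coe_nonneg) (hν.smul c)
    (Finset.univ.filter fun r => IsNondegenerate A ν r)
    fun r hr => (Finset.mem_filter.1 hr).2.smul hc
  refine ⟨fun j => (j : ℕ) • v + (p + 1 - j) • u, fun j => ?_, fun r hr i j hij heq => hij ?_⟩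
  · have hj : convPow π (p + 1) = convPow π ((j : ℕ) + (p + 1 - j)) := by congr 1; omega
    rw [hj]
    exact nsmul_add_nsmul_mem_support_convPow hv hu _ _
  · have hd : v r - u r ≠ 0 := sub_ne_zero.2 (huv r (by simpa using hr)).symm
    simp only [PiLp.add_apply, PiLp.smul_apply, nsmul_eq_mul, Nat.cast_sub i.2.le,
      Nat.cast_sub j.2.le] at heq
    have hij' : ((i : ℕ) : ℝ) = (j : ℕ) := mul_right_cancel₀ hd (by linarith)
    exact Fin.ext (by exact_mod_cast hij')

/-- If the coordinates on which `γ` lives are pairwise distinct along `w`, then one of the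
translates by `w` controls the growth weight. -/
lemma exists_growth_le_sum {γ : Fin p → ℝ} (hγ : ∀ r, 0 ≤ γ r)
    (w : Fin (p + 1) → EuclideanSpace ℝ (Fin p))
    (hw : ∀ r, γ r ≠ 0 → ∀ i j, i ≠ j → w i r ≠ w j r) :
    ∃ K : ℝ, 0 ≤ K ∧ ∀ x, growth γ x ≤ K * ∑ j, ∏ r, |w j r + x r| ^ γ r := by
  obtain ⟨δ, hδ, hδ0⟩ : ∃ δ : ℝ, (∀ r i j, γ r ≠ 0 → i ≠ j → 2 * δ < |w i r - w j r|) ∧ 0 < δ := by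
    have hev : ∀ᶠ δ : ℝ in 𝓝[>] 0, ∀ r i j, γ r ≠ 0 → i ≠ j → 2 * δ < |w i r - w j r| := by
      simp only [eventually_all]
      intro r i j hr hij
      have hpos : 0 < |w i r - w j r| / 2 := by
        have := abs_pos.2 (sub_ne_zero.2 (hw r hr i j hij))
        positivity
      filter_upwards [Ioo_mem_nhdsGT hpos] with δ hδ
      linarith [hδ.2]
    exact (hev.and self_mem_nhdsWithin).exists
  obtain ⟨M, hM, hM0⟩ : ∃ M : ℝ, (∀ j r, |w j r| ≤ M) ∧ 0 ≤ M := by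
    have hev : ∀ᶠ M : ℝ in atTop, ∀ j r, |w j r| ≤ M := by
      simp only [eventually_all]
      exact fun j r => eventually_ge_atTop _
    exact (hev.and (eventually_ge_atTop 0)).exists
  have hC : 0 ≤ (1 + M) / δ + 1 := by positivity
  refine ⟨∏ r, ((1 + M) / δ + 1) ^ γ r, Finset.prod_nonneg fun _ _ => by positivity, fun x => ?_⟩
  obtain ⟨j, hj⟩ := exists_forall_not (p := p)
    (bad := fun j r => γ r ≠ 0 ∧ |w j r + x r| < δ) fun r i j ⟨hr, hi⟩ ⟨_, hj⟩ => by
      by_contra hij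
      have h1 := hδ r i j hr hij
      have h2 := abs_sub (w i r + x r) (w j r + x r)
      rw [add_sub_add_right_eq_sub] at h2
      linarith
  calc growth γ x ≤ ∏ r, (((1 + M) / δ + 1) ^ γ r * |w j r + x r| ^ γ r) := by
        refine Finset.prod_le_prod (fun r _ => by positivity) fun r _ => ?_
        by_cases hr : γ r = 0
        · simp [hr]
        · have h1 : δ ≤ |w j r + x r| := by
            have := hj r
            simpa [hr] using this
          rw [← Real.mul_rpow hC (abs_nonneg _)]
          refine Real.rpow_le_rpow (by positivity) ?_ (hγ r)
          have h2 : |x r| ≤ |w j r + x r| + |w j r| := by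
            have := abs_sub (w j r + x r) (w j r)
            rwa [add_sub_cancel_left] at this
          have h3 : 1 + M ≤ (1 + M) / δ * |w j r + x r| := by
            rw [div_mul_eq_mul_div, le_div_iff₀ hδ0]
            gcongr
          have h4 := hM j r
          rw [add_mul]
          linarith
    _ = (∏ r, ((1 + M) / δ + 1) ^ γ r) * ∏ r, |w j r + x r| ^ γ r := Finset.prod_mul_distrib
    _ ≤ _ := by
        refine mul_le_mul_of_nonneg_left ?_ (Finset.prod_nonneg fun _ _ => by positivity)
        exact Finset.single_le_sum (f := fun j => ∏ r, |w j r + x r| ^ γ r)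
          (fun i _ => Finset.prod_nonneg fun _ _ => by positivity) (Finset.mem_univ j)

/-- Fubini: a finite integral against a convolution with a compound Poisson law bounds the
integrals of almost all translates against the jump measure. -/
lemma ae_lintegral_add_lt_top [IsFiniteMeasure μ] [IsFiniteMeasure ρ]
    {f : EuclideanSpace ℝ (Fin p) → ℝ≥0∞} (hf : Measurable f)
    (h : ∫⁻ x, f x ∂(μ ∗ compoundPoisson ρ) < ⊤) : ∀ᵐ w ∂μ, ∫⁻ x, f (w + x) ∂ρ < ⊤ := by
  rw [Measure.lintegral_conv hf] at h
  have hm : Measurable fun w => ∫⁻ x, f (w + x) ∂(compoundPoisson ρ) :=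
    Measurable.lintegral_prod_right (by fun_prop)
  filter_upwards [ae_lt_top hm h.ne] with w hw
  have hle := (lintegral_mono' (le_compoundPoisson ρ) (le_refl fun x => f (w + x))).trans_lt hw
  rw [lintegral_smul_measure] at hle
  exact ENNReal.lt_top_of_mul_ne_top_right hle.ne
    (ENNReal.ofReal_pos.2 (jumpWeight_pos ρ 1)).ne'

lemma HasLevyTriplet.lintegral_growth_jumps_lt_top [IsProbabilityMeasure μ] [IsFiniteMeasure ρ]
    (h : HasLevyTriplet μ a A ν) (hA : A.PosSemidef) (hν : IsLevyMeasure ν) {γ : Fin p → ℝ}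
    (hγ : ∀ r, 0 ≤ γ r) (hγν : ∀ r, γ r ≠ 0 → IsNondegenerate A ν r)
    (hfin : ∫⁻ x, ENNReal.ofReal (∏ r, |x r| ^ γ r) ∂(μ ∗ compoundPoisson ρ) < ⊤) :
    ∫⁻ x, ENNReal.ofReal (growth γ x) ∂ρ < ⊤ := by
  have hae := ae_lintegral_add_lt_top (by fun_prop) hfin
  obtain ⟨w, hw, hne⟩ := h.exists_family_mem_support hA hν
  have hopen : IsOpen {w : Fin (p + 1) → EuclideanSpace ℝ (Fin p) |
      ∀ r, γ r ≠ 0 → ∀ i j, i ≠ j → w i r ≠ w j r} := by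
    simp only [Set.ofPred_forall]
    refine isOpen_iInter_of_finite fun r => isOpen_iInter_of_finite fun _ =>
      isOpen_iInter_of_finite fun i => isOpen_iInter_of_finite fun j =>
        isOpen_iInter_of_finite fun _ => isOpen_ne_fun (by fun_prop) (by fun_prop)
  have hcl : w ∈ closure (Set.univ.pi fun _ : Fin (p + 1) =>
      {w | ∫⁻ x, ENNReal.ofReal (∏ r, |(w + x) r| ^ γ r) ∂ρ < ⊤}) := by
    rw [closure_pi_set]
    exact fun j _ => support_subset_closure hae (hw j)
  obtain ⟨w', hw', hfin'⟩ := mem_closure_iff.1 hcl _ hopen fun r hr => hne r (hγν r hr)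
  obtain ⟨K, hK, hle⟩ := exists_growth_le_sum hγ w' hw'
  calc _ ≤ ∫⁻ x, ENNReal.ofReal K * ∑ j, ENNReal.ofReal (∏ r, |(w' j + x) r| ^ γ r) ∂ρ := by
        refine lintegral_mono fun x => ?_
        rw [← ENNReal.ofReal_sum_of_nonneg
          fun j _ => Finset.prod_nonneg fun _ _ => by positivity, ← ENNReal.ofReal_mul hK]
        exact ENNReal.ofReal_le_ofReal (hle x)
    _ < ⊤ := by
        rw [lintegral_const_mul _ (by fun_prop), lintegral_finsetSum _ fun σ _ => by fun_prop]
        exact ENNReal.mul_lt_top ENNReal.ofReal_lt_top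
          (ENNReal.sum_lt_top.2 fun j _ => hfin' j (Set.mem_univ j))

/-- Finite mixed moments of a law without vanishing marginals give finite mixed moments of the
large jumps. -/
theorem HasLevyTriplet.lintegral_restrict_lt_top [IsProbabilityMeasure μ]
    (h : HasLevyTriplet μ a A ν) (hA : A.PosSemidef) (hν : IsLevyMeasure ν) {τ : ℝ} (hτ : 0 < τ)
    {β : Fin p → ℝ} (hβ : ∀ r, 0 ≤ β r) (hnz : ∀ r, ¬ ∀ᵐ x ∂μ, x r = 0)
    (hfin : ∫⁻ x, ENNReal.ofReal (∏ r, |x r| ^ β r) ∂μ < ⊤) {α : Fin p → ℝ}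
    (hα : ∀ r, α r ∈ Set.Icc 0 (β r)) :
    ∫⁻ x, ENNReal.ofReal (∏ r, |x r| ^ α r) ∂(ν.restrict {x | τ ≤ ‖x‖}) < ⊤ := by
  classical
  let γ : Fin p → ℝ := fun r => if IsNondegenerate A ν r then β r else 0
  have hγ (r : Fin p) : 0 ≤ γ r := by
    simp only [γ]; split_ifs
    exacts [hβ r, le_rfl]
  have hfinite := hν.isFiniteMeasure_restrict hτ
  set ν₁ := ν.restrict {x | τ ≤ ‖x‖} with hν₁
  have hν₁L : IsLevyMeasure ν₁ := hν.mono Measure.restrict_le_self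
  let ν₀ := ν.restrict {x | ‖x‖ < τ} + (2⁻¹ : ℝ≥0) • ν₁
  have hν₀L : IsLevyMeasure ν₀ := (hν.mono Measure.restrict_le_self).add (hν₁L.smul _)
  have hsplit : ν₀ + (2⁻¹ : ℝ≥0) • ν₁ = ν := by
    rw [add_assoc, ← add_smul, show (2⁻¹ + 2⁻¹ : ℝ≥0) = 1 by
      rw [← two_mul, mul_inv_cancel₀ two_ne_zero], one_smul, hν₁, restrict_lt_add_restrict_le]
  -- In degenerate coordinates the law is a nonzero constant, so these may be dropped.
  have hfinγ : ∫⁻ x, ENNReal.ofReal (∏ r, |x r| ^ γ r) ∂μ < ⊤ := by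
    let c : ℝ := ∏ r, if IsNondegenerate A ν r then 1 else |a r| ^ β r
    have hae (r : Fin p) : ∀ᵐ x ∂μ, ¬ IsNondegenerate A ν r → x r = a r := by
      by_cases hr : IsNondegenerate A ν r
      · exact .of_forall fun x hx => absurd hr hx
      · filter_upwards [h.ae_eq_of_not_isNondegenerate hr] with x hx _ using hx
    have ha (r : Fin p) (hr : ¬ IsNondegenerate A ν r) : a r ≠ 0 := fun h0 => hnz r <| by
      filter_upwards [h.ae_eq_of_not_isNondegenerate hr] with x hx
      rw [hx, h0]
    have hc : 0 < c := Finset.prod_pos fun r _ => by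
      split_ifs with hr
      · exact one_pos
      · exact Real.rpow_pos_of_pos (abs_pos.2 (ha r hr)) _
    have heq : ∀ᵐ x ∂μ, ENNReal.ofReal (∏ r, |x r| ^ γ r)
        = ENNReal.ofReal c⁻¹ * ENNReal.ofReal (∏ r, |x r| ^ β r) := by
      filter_upwards [ae_all_iff.2 hae] with x hx
      rw [← ENNReal.ofReal_mul (inv_nonneg.2 hc.le)]
      congr 1
      rw [eq_inv_mul_iff_mul_eq₀ hc.ne', ← Finset.prod_mul_distrib]
      refine Finset.prod_congr rfl fun r _ => ?_
      by_cases hr : IsNondegenerate A ν r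
      · simp [γ, hr]
      · simp [γ, hr, hx r hr]
    rw [lintegral_congr_ae heq, lintegral_const_mul _ (by fun_prop)]
    exact ENNReal.mul_lt_top ENNReal.ofReal_lt_top hfin
  have hnd (r : Fin p) (hr : γ r ≠ 0) : IsNondegenerate A ν₀ r := by
    have hr' : IsNondegenerate A ν r := by
      by_contra hcon
      exact hr (by simp [γ, hcon])
    refine hr'.imp_right fun hne h0 => hne ?_
    have h1 : ν.restrict {x | ‖x‖ < τ} {x | x r ≠ 0} = 0 ∧ ν₁ {x | x r ≠ 0} = 0 := by
      simpa [ν₀] using h0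
    rw [← restrict_lt_add_restrict_le ν τ, Measure.add_apply, h1.1, ← hν₁, h1.2, add_zero]
  rw [← hsplit] at h
  obtain ⟨η, hη, hηT, rfl⟩ := h.exists_conv_compoundPoisson hA hν₀L (hν₁L.smul _)
  have hg := hηT.lintegral_growth_jumps_lt_top hA hν₀L hγ hnd hfinγ
  have hg₁ : ∫⁻ x, ENNReal.ofReal (growth γ x) ∂ν₁ < ⊤ := by
    rw [lintegral_smul_measure] at hg
    exact ENNReal.lt_top_of_mul_ne_top_right hg.ne (by simp)
  refine lt_of_le_of_lt (lintegral_mono_ae ?_) hg₁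
  have hzero (r : Fin p) : ∀ᵐ x ∂ν₁, ¬ IsNondegenerate A ν r → x r = 0 := by
    by_cases hr : IsNondegenerate A ν r
    · exact .of_forall fun x hx => absurd hr hx
    · simp only [IsNondegenerate, not_or, not_not] at hr
      filter_upwards [ae_restrict_of_ae (ae_iff.2 hr.2)] with x hx _ using hx
  filter_upwards [ae_all_iff.2 hzero] with x hx
  refine ENNReal.ofReal_le_ofReal (Finset.prod_le_prod (fun r _ => by positivity) fun r _ => ?_)
  by_cases hr : IsNondegenerate A ν r
  · calc |x r| ^ α r ≤ (1 + |x r|) ^ α r :=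
        Real.rpow_le_rpow (abs_nonneg _) (by linarith) (hα r).1
      _ ≤ (1 + |x r|) ^ β r :=
        Real.rpow_le_rpow_of_exponent_le (by linarith [abs_nonneg (x r)]) (hα r).2
      _ = _ := by simp [γ, hr]
  · simpa [γ, hr, hx r hr] using Real.zero_rpow_le_one (α r)

end Necessity

end LevyKhintchine

/-- **Corollary 2.** Let `X = (X₁,…,X_p)` be an infinitely divisible random vector with
Lévy–Khintchine characteristic function with Lévy measure `ν`, let `β_r ∈ [0,∞)`, and
assume `P(X_r = 0) < 1` for each `r`.  Then `E(∏ r, |X_r|^{β_r}) < ∞` if and only if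
`∫ ∏ r, |x_r|^{α_r} dν₁(x) < ∞` for all `α_r ∈ [0, β_r]`, where `ν₁` is the restriction
of `ν` to `{x : ‖x‖ ≥ τ}`. -/
theorem max_moment_iff_levy_restriction_moments
    {Ω : Type*} [MeasurableSpace Ω] (P : Measure Ω) [IsProbabilityMeasure P]
    (p : ℕ) (hp : 1 ≤ p)
    (X : Ω → EuclideanSpace ℝ (Fin p)) (hX : Measurable X)
    (a : EuclideanSpace ℝ (Fin p))
    (A : Matrix (Fin p) (Fin p) ℝ) (hA : A.PosSemidef)
    (ν : Measure (EuclideanSpace ℝ (Fin p)))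
    (hν0 : ν {0} = 0)
    (hνint : ∫⁻ x, ENNReal.ofReal (‖x‖ ^ 2 / (1 + ‖x‖ ^ 2)) ∂ν < ⊤)
    (hφ : ∀ t : EuclideanSpace ℝ (Fin p),
      ∫ ω, Complex.exp (Complex.I * ((⟪t, X ω⟫ : ℝ) : ℂ)) ∂P =
        Complex.exp (Complex.I * ((⟪a, t⟫ : ℝ) : ℂ)
          - ((∑ i, ∑ j, A i j * t i * t j : ℝ) : ℂ) / 2
          + ∫ x, (Complex.exp (Complex.I * ((⟪t, x⟫ : ℝ) : ℂ)) - 1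
              - Complex.I * ((⟪t, x⟫ : ℝ) : ℂ) / ((1 + ‖x‖ ^ 2 : ℝ) : ℂ)) ∂ν))
    (β : Fin p → ℝ) (hβ : ∀ r, 0 ≤ β r)
    (hnz : ∀ r, P {ω | X ω r = 0} < 1)
    (τ : ℝ) (hτ : 0 < τ) :
    (∫⁻ ω, ENNReal.ofReal (∏ r, |X ω r| ^ β r) ∂P < ⊤) ↔
      (∀ α : Fin p → ℝ, (∀ r, α r ∈ Set.Icc 0 (β r)) →
        ∫⁻ x, ENNReal.ofReal (∏ r, |x r| ^ α r) ∂(ν.restrict {x | τ ≤ ‖x‖}) < ⊤) := by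
  have hT : LevyKhintchine.HasLevyTriplet (P.map X) a A ν := fun t => by
    rw [charFun_apply, integral_map hX.aemeasurable (by fun_prop)]
    simp_rw [real_inner_comm, mul_comm _ Complex.I]
    exact hφ t
  have hν : LevyKhintchine.IsLevyMeasure ν := ⟨hν0, hνint⟩
  have := Measure.isProbabilityMeasure_map (μ := P) hX.aemeasurable
  rw [← lintegral_map (μ := P) (f := fun x => ENNReal.ofReal (∏ r, |x r| ^ β r)) (by fun_prop) hX]
  refine ⟨fun h α hα => hT.lintegral_restrict_lt_top hA hν hτ hβ (fun r hr => ?_) h hα,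
    hT.lintegral_prod_lt_top hA hν hτ hβ⟩
  have hr' : ∀ᵐ ω ∂P, X ω r = 0 := ae_of_ae_map hX.aemeasurable hr
  exact (hnz r).ne ((measure_congr (Filter.eventuallyEq_univ.2 hr')).trans measure_univ)
end

section
/- (Example 1, second claim) For every τ > 0, the function g₁ on ℝ² defined by g₁(x₁,x₂) = |x₁ x₂| if ‖(x₁,x₂)‖ ≥ τ and g₁(x₁,x₂) = 0 otherwise, is not submultiplicative; and for every c > 0, the function (x₁,x₂) ↦ max{|x₁ x₂|, c} on ℝ² is not submultiplicative. -/
/-- **Example 1, second claim.** For every `τ > 0`, the function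
`g₁(x₁,x₂) = |x₁x₂|·𝟙{‖(x₁,x₂)‖ ≥ τ}` on `ℝ²` is not submultiplicative, and for every
`c > 0` the function `(x₁,x₂) ↦ max {|x₁x₂|, c}` is not submultiplicative. -/
theorem truncated_abs_mul_and_max_not_submultiplicative :
    (∀ τ : ℝ, 0 < τ →
      ¬ ∃ a : ℝ, 0 < a ∧ ∀ x y : ℝ × ℝ,
        (if τ ≤ Real.sqrt ((x.1 + y.1) ^ 2 + (x.2 + y.2) ^ 2) then
            |(x.1 + y.1) * (x.2 + y.2)| else 0) ≤
          a * (if τ ≤ Real.sqrt (x.1 ^ 2 + x.2 ^ 2) then |x.1 * x.2| else 0)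
            * (if τ ≤ Real.sqrt (y.1 ^ 2 + y.2 ^ 2) then |y.1 * y.2| else 0)) ∧
    (∀ c : ℝ, 0 < c →
      ¬ ∃ a : ℝ, 0 < a ∧ ∀ x y : ℝ × ℝ,
        max |(x.1 + y.1) * (x.2 + y.2)| c ≤
          a * max |x.1 * x.2| c * max |y.1 * y.2| c) := by
  constructor
  · rintro τ hτ ⟨a, -, h⟩
    have h₁ := h (τ, 0) (0, τ)
    have hle : τ ≤ Real.sqrt (τ ^ 2 + τ ^ 2) := Real.le_sqrt_of_sq_le (by nlinarith)
    simp only [add_zero, zero_add, mul_zero, zero_mul, abs_zero, ite_self, if_pos hle] at h₁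
    exact (abs_pos.mpr (mul_pos hτ hτ).ne').not_ge h₁
  · rintro c hc ⟨a, ha, h⟩
    have h₁ := h (a * c * c + 1, 0) (0, a * c * c + 1)
    simp only [add_zero, zero_add, mul_zero, zero_mul, abs_zero, max_eq_right hc.le] at h₁
    have h₂ := (le_abs_self _).trans ((le_max_left _ _).trans h₁)
    have hpos : 0 < a * c * c := by positivity
    nlinarith
end

section
/- (Example 2) Let C be a standard Cauchy random variable and set V = |C|. Let λ ∈ (0,∞) and let (X₁,X₂) be a random vector on ℝ² whose characteristic function φ satisfies φ(t) = exp(−λ + λ ψ(t)) for all t ∈ ℝ², where ψ is the characteristic function of the random vector (V, V⁻¹). Let ν = λ·(the distribution of (V, V⁻¹)) on ℝ². Then: (i) for all α₁, α₂ ∈ [0,1] with |α₁ − α₂| < 1, ∫_{ℝ²} |x₁|^{α₁} |x₂|^{α₂} dν(x) < ∞ (in particular this holds whenever α₁, α₂ both lie in (0,1]); yet (ii) E(|X₁ X₂|) = ∞ and E(|X₁|) = E(|X₂|) = ∞. -/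
open MeasureTheory ProbabilityTheory

open scoped ENNReal Nat

section CompoundPoisson

variable {E : Type*} [NormedAddCommGroup E] [MeasurableSpace E]

/-- The `n`-fold convolution power of a measure. -/
noncomputable def convPow (μ : Measure E) : ℕ → Measure E
  | 0 => Measure.dirac 0
  | n + 1 => (convPow μ n).conv μ

/-- The compound Poisson distribution with intensity `lam` and jump distribution `μ`. -/
noncomputable def compoundPoisson (lam : ℝ) (μ : Measure E) : Measure E :=
  Measure.sum fun n ↦ ENNReal.ofReal (Real.exp (-lam) * lam ^ n / n !) • convPow μ n

/-- Each mixture component bounds the compound Poisson distribution from below. -/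
lemma lintegral_compoundPoisson_eq_top {lam : ℝ} (hlam : 0 < lam) {μ : Measure E} {f : E → ℝ≥0∞}
    (n : ℕ) (hf : ∫⁻ x, f x ∂(convPow μ n) = ⊤) : ∫⁻ x, f x ∂(compoundPoisson lam μ) = ⊤ := by
  refine eq_top_mono (lintegral_mono' (Measure.le_sum _ n) le_rfl) ?_
  rw [lintegral_smul_measure, hf, smul_eq_mul, ENNReal.mul_top]
  simp only [ne_eq, ENNReal.ofReal_eq_zero, not_le]
  positivity

variable [BorelSpace E] [SecondCountableTopology E] (μ : Measure E) [IsProbabilityMeasure μ]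

instance isProbabilityMeasure_convPow (n : ℕ) : IsProbabilityMeasure (convPow μ n) := by
  induction n with
  | zero => exact inferInstanceAs (IsProbabilityMeasure (Measure.dirac 0))
  | succ n _ => exact inferInstanceAs (IsProbabilityMeasure ((convPow μ n).conv μ))

lemma convPow_one : convPow μ 1 = μ := Measure.dirac_zero_conv μ

lemma convPow_two : convPow μ 2 = μ.conv μ :=
  congrArg (Measure.conv · μ) (convPow_one μ)

lemma isProbabilityMeasure_compoundPoisson {lam : ℝ} (hlam : 0 ≤ lam) :
    IsProbabilityMeasure (compoundPoisson lam μ) := by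
  have h : HasSum (fun n ↦ Real.exp (-lam) * lam ^ n / n !) 1 :=
    hasSum_one_poissonMeasure ⟨lam, hlam⟩
  constructor
  rw [compoundPoisson, Measure.sum_apply _ MeasurableSet.univ]
  simp only [Measure.smul_apply, measure_univ, smul_eq_mul, mul_one]
  rw [← ENNReal.ofReal_tsum_of_nonneg (fun n ↦ by positivity) h.summable, h.tsum_eq,
    ENNReal.ofReal_one]

variable [NormedSpace ℝ E]

lemma charFunDual_convPow (n : ℕ) (L : StrongDual ℝ E) :
    charFunDual (convPow μ n) L = charFunDual μ L ^ n := by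
  induction n with
  | zero => simp [convPow]
  | succ n ih => rw [convPow, charFunDual_conv, ih, pow_succ]

lemma charFunDual_compoundPoisson {lam : ℝ} (hlam : 0 ≤ lam) (L : StrongDual ℝ E) :
    charFunDual (compoundPoisson lam μ) L
      = Complex.exp (-(lam : ℂ) + lam * charFunDual μ L) := by
  have := isProbabilityMeasure_compoundPoisson μ hlam
  have hfint : Integrable (fun x ↦ Complex.exp (L x * Complex.I)) (compoundPoisson lam μ) :=
    Integrable.of_bound (by fun_prop) 1 (by simp [Complex.norm_exp_ofReal_mul_I])
  refine (hasSum_integral_measure hfint).unique ?_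
  have hexp := NormedSpace.expSeries_div_hasSum_exp ((lam : ℂ) * charFunDual μ L)
  rw [← Complex.exp_eq_exp_ℂ] at hexp
  rw [Complex.exp_add]
  convert! hexp.mul_left (Complex.exp (-(lam : ℂ))) using 2 with n
  rw [integral_smul_measure, ← charFunDual_apply, charFunDual_convPow,
    ENNReal.toReal_ofReal (by positivity), Complex.real_smul]
  push_cast
  ring

end CompoundPoisson

section CauchyIntegrals

/-- Expectations of nonnegative functions under the standard Cauchy law. -/
lemma lintegral_of_map_eq_cauchy {Ω : Type*} [MeasurableSpace Ω] {P : Measure Ω} {C : Ω → ℝ}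
    (hC : Measurable C)
    (hCauchy : P.map C = volume.withDensity
      (fun x ↦ ENNReal.ofReal (1 / (Real.pi * (1 + x ^ 2)))))
    {g : ℝ → ℝ} (hg : Measurable g) :
    ∫⁻ ω, ENNReal.ofReal (g (C ω)) ∂P
      = ∫⁻ x, ENNReal.ofReal (1 / (Real.pi * (1 + x ^ 2)) * g x) := by
  rw [← lintegral_map (f := fun x ↦ ENNReal.ofReal (g x)) (by fun_prop) hC, hCauchy,
    lintegral_withDensity_eq_lintegral_mul _ (by fun_prop) (by fun_prop)]
  refine lintegral_congr fun x ↦ ?_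
  rw [Pi.mul_apply, ← ENNReal.ofReal_mul (by positivity)]

/-- A function dominating a positive multiple of `x⁻¹` on a set of positive reals where `x⁻¹` is
not integrable has infinite integral. -/
lemma lintegral_eq_top_of_inv_le {s : Set ℝ} (hs : MeasurableSet s) (hs0 : ∀ x ∈ s, 0 < x)
    (hinv : ¬ IntegrableOn (fun x : ℝ ↦ x⁻¹) s) {c : ℝ} (hc : 0 < c) {g : ℝ → ℝ}
    (hg : ∀ x ∈ s, c * x⁻¹ ≤ g x) : ∫⁻ x, ENNReal.ofReal (g x) = ⊤ := by
  have htop : ∫⁻ x in s, ENNReal.ofReal x⁻¹ = ⊤ := by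
    by_contra h
    refine hinv ⟨by fun_prop, ?_⟩
    rw [hasFiniteIntegral_iff_ofReal]
    · exact lt_top_iff_ne_top.2 h
    · exact (ae_restrict_mem hs).mono fun x hx ↦ (inv_pos.2 (hs0 x hx)).le
  refine eq_top_mono (setLIntegral_le_lintegral s _) ?_
  refine eq_top_mono (setLIntegral_mono' (f := fun x ↦ ENNReal.ofReal c * ENNReal.ofReal x⁻¹) hs
    fun x hx ↦ ?_) ?_
  · rw [← ENNReal.ofReal_mul hc.le]
    exact ENNReal.ofReal_le_ofReal (hg x hx)
  · rw [lintegral_const_mul _ (by fun_prop), htop, ENNReal.mul_top (by simpa using hc)]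

lemma lintegral_cauchy_abs :
    ∫⁻ x : ℝ, ENNReal.ofReal (1 / (Real.pi * (1 + x ^ 2)) * |x|) = ⊤ := by
  refine lintegral_eq_top_of_inv_le (s := Set.Ioi 1) measurableSet_Ioi
    (fun x hx ↦ one_pos.trans hx) not_integrableOn_Ioi_inv
    (c := 1 / (2 * Real.pi)) (by positivity) fun x hx ↦ ?_
  have hx1 : 1 < x := hx
  have hx0 : 0 < x := by linarith
  rw [abs_of_pos hx0, ← div_eq_mul_inv, div_div, one_div_mul_eq_div,
    div_le_div_iff₀ (by positivity) (by positivity)]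
  nlinarith [Real.pi_pos, mul_pos Real.pi_pos (show 0 < x ^ 2 - 1 by nlinarith)]

lemma lintegral_cauchy_abs_inv :
    ∫⁻ x : ℝ, ENNReal.ofReal (1 / (Real.pi * (1 + x ^ 2)) * |x|⁻¹) = ⊤ := by
  refine lintegral_eq_top_of_inv_le (s := Set.Ioo 0 1) measurableSet_Ioo
    (fun x hx ↦ hx.1) ?_ (c := 1 / (2 * Real.pi)) (by positivity) fun x hx ↦ ?_
  · have h := (intervalIntegral.integrableOn_Ioo_rpow_iff (s := -1) one_pos).not.2 (lt_irrefl _)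
    simpa only [Real.rpow_neg_one] using h
  · rw [abs_of_pos hx.1]
    refine mul_le_mul_of_nonneg_right ?_ (inv_nonneg.2 hx.1.le)
    refine one_div_le_one_div_of_le (by positivity) ?_
    have hsq : 0 ≤ 1 - x ^ 2 := by nlinarith [hx.1, hx.2]
    nlinarith [mul_nonneg Real.pi_pos.le hsq]

lemma integrable_abs_rpow_div_one_add_sq {β : ℝ} (hβ : |β| < 1) :
    Integrable fun x : ℝ ↦ |x| ^ β * (1 + x ^ 2)⁻¹ := by
  obtain ⟨h1, h2⟩ := abs_lt.1 hβ
  have hcont : Continuous fun x : ℝ ↦ (1 + x ^ 2)⁻¹ :=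
    Continuous.inv₀ (by fun_prop) fun x ↦ by positivity
  have hpos : IntegrableOn (fun x : ℝ ↦ |x| ^ β * (1 + x ^ 2)⁻¹) (Set.Ioi 0) := by
    have h := mellin_convergent_of_isBigO_scalar (a := 2) (b := 0) (s := β + 1)
      (f := fun x : ℝ ↦ (1 + x ^ 2)⁻¹) (hcont.locallyIntegrable.locallyIntegrableOn _)
      (.of_bound 1 ?_) (by linarith) (.of_bound 1 ?_) (by linarith)
    · refine h.congr_fun (fun x hx ↦ ?_) measurableSet_Ioi
      simp only [add_sub_cancel_right, abs_of_pos (Set.mem_Ioi.1 hx)]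
    · filter_upwards [Filter.eventually_gt_atTop 0] with x hx
      rw [Real.rpow_neg hx.le, Real.rpow_two, one_mul, norm_inv, norm_inv,
        Real.norm_of_nonneg (by positivity), Real.norm_of_nonneg (by positivity)]
      exact inv_anti₀ (by positivity) (by linarith)
    · filter_upwards with x
      rw [norm_inv, Real.norm_of_nonneg (by positivity)]
      simpa using inv_le_one_of_one_le₀ (by nlinarith [sq_nonneg x] : 1 ≤ 1 + x ^ 2)
  have hneg : IntegrableOn (fun x : ℝ ↦ |x| ^ β * (1 + x ^ 2)⁻¹) (Set.Iio 0) := by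
    have h := ((Measure.measurePreserving_neg (volume : Measure ℝ)).integrableOn_comp_preimage
      (MeasurableEquiv.neg ℝ).measurableEmbedding).2 hpos
    simpa [Function.comp_def] using h
  rw [← integrableOn_univ, ← Set.Iic_union_Ioi (a := (0 : ℝ))]
  exact ((integrableOn_Iic_iff_integrableOn_Iio (by simp)).2 hneg).union hpos

lemma lintegral_cauchy_rpow_lt_top {α₁ α₂ : ℝ} (h : |α₁ - α₂| < 1) :
    ∫⁻ x : ℝ, ENNReal.ofReal (1 / (Real.pi * (1 + x ^ 2)) * (|x| ^ α₁ * |x|⁻¹ ^ α₂)) < ⊤ := by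
  refine lt_of_eq_of_lt (lintegral_congr_ae ?_)
    ((integrable_abs_rpow_div_one_add_sq h).const_mul Real.pi⁻¹).lintegral_lt_top
  filter_upwards [Measure.ae_ne volume (0 : ℝ)] with x hx
  have hx' : 0 < |x| := abs_pos.2 hx
  rw [Real.inv_rpow hx'.le, Real.rpow_sub hx', one_div, mul_inv, div_eq_mul_inv]
  congr 1
  ring

end CauchyIntegrals

/-- **Example 2.** Let `V = |C|` with `C` standard Cauchy, `λ > 0`, and let `(X₁,X₂)` be a
random vector whose characteristic function is `exp(−λ + λψ(t))`, where `ψ` is the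
characteristic function of `(V, V⁻¹)`.  With `ν = λ·law(V, V⁻¹)`: for all
`α₁, α₂ ∈ [0,1]` with `|α₁ − α₂| < 1` one has `∫ |x₁|^{α₁}|x₂|^{α₂} dν < ∞`, yet
`E|X₁X₂| = ∞` and `E|X₁| = E|X₂| = ∞`. -/
theorem example2_compound_poisson_cauchy
    {Ω : Type*} [MeasurableSpace Ω] (P : Measure Ω) [IsProbabilityMeasure P]
    (C : Ω → ℝ) (hC : Measurable C)
    (hCauchy : P.map C = volume.withDensity
      (fun x => ENNReal.ofReal (1 / (Real.pi * (1 + x ^ 2)))))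
    (V : Ω → ℝ) (hV : V = fun ω => |C ω|)
    (lam : ℝ) (hlam : 0 < lam)
    (X₁ X₂ : Ω → ℝ) (hX₁ : Measurable X₁) (hX₂ : Measurable X₂)
    (hφ : ∀ t : ℝ × ℝ,
      ∫ ω, Complex.exp (Complex.I * ((t.1 * X₁ ω + t.2 * X₂ ω : ℝ) : ℂ)) ∂P =
        Complex.exp (-(lam : ℂ) + (lam : ℂ) *
          ∫ ω, Complex.exp (Complex.I * ((t.1 * V ω + t.2 * (V ω)⁻¹ : ℝ) : ℂ)) ∂P))
    (ν : Measure (ℝ × ℝ))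
    (hν : ν = (ENNReal.ofReal lam) • P.map (fun ω => (V ω, (V ω)⁻¹))) :
    (∀ α₁ α₂ : ℝ, α₁ ∈ Set.Icc (0:ℝ) 1 → α₂ ∈ Set.Icc (0:ℝ) 1 → |α₁ - α₂| < 1 →
      ∫⁻ x, ENNReal.ofReal (|x.1| ^ α₁ * |x.2| ^ α₂) ∂ν < ⊤) ∧
    (∫⁻ ω, ENNReal.ofReal |X₁ ω * X₂ ω| ∂P = ⊤) ∧
    (∫⁻ ω, ENNReal.ofReal |X₁ ω| ∂P = ⊤) ∧
    (∫⁻ ω, ENNReal.ofReal |X₂ ω| ∂P = ⊤) := by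
  have hV0 : ∀ ω, 0 ≤ V ω := fun ω ↦ by simp [hV]
  have hVm : Measurable V := by rw [hV]; fun_prop
  have hWm : Measurable fun ω ↦ (V ω, (V ω)⁻¹) := by fun_prop
  have hEV : ∫⁻ ω, ENNReal.ofReal (V ω) ∂P = ⊤ := by
    rw [hV, lintegral_of_map_eq_cauchy hC hCauchy (g := fun x ↦ |x|) (by fun_prop),
      lintegral_cauchy_abs]
  have hEVinv : ∫⁻ ω, ENNReal.ofReal (V ω)⁻¹ ∂P = ⊤ := by
    rw [hV, lintegral_of_map_eq_cauchy hC hCauchy (g := fun x ↦ |x|⁻¹) (by fun_prop),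
      lintegral_cauchy_abs_inv]
  set μ := P.map fun ω ↦ (V ω, (V ω)⁻¹) with hμ
  have : IsProbabilityMeasure μ := Measure.isProbabilityMeasure_map hWm.aemeasurable
  have := isProbabilityMeasure_compoundPoisson μ hlam.le
  have hXm : Measurable fun ω ↦ (X₁ ω, X₂ ω) := by fun_prop
  have hlaw : P.map (fun ω ↦ (X₁ ω, X₂ ω)) = compoundPoisson lam μ := by
    have : IsProbabilityMeasure (P.map fun ω ↦ (X₁ ω, X₂ ω)) :=
      Measure.isProbabilityMeasure_map hXm.aemeasurable
    refine Measure.ext_of_charFunDual (funext fun L ↦ ?_)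
    have hL : ∀ a b : ℝ, L (a, b) = L (1, 0) * a + L (0, 1) * b := fun a b ↦ by
      have hab : ((a, b) : ℝ × ℝ) = a • (1, 0) + b • (0, 1) := by simp
      rw [hab, map_add, map_smul, map_smul, smul_eq_mul, smul_eq_mul, mul_comm a, mul_comm b]
    rw [charFunDual_compoundPoisson μ hlam.le, charFunDual_apply, charFunDual_apply, hμ,
      integral_map hXm.aemeasurable (by fun_prop), integral_map hWm.aemeasurable (by fun_prop)]
    simp_rw [hL (X₁ _), hL (V _), mul_comm _ Complex.I]
    exact hφ (L (1, 0), L (0, 1))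
  have hX : ∀ {f : ℝ × ℝ → ℝ}, Measurable f → ∀ n,
      ∫⁻ x, ENNReal.ofReal (f x) ∂(convPow μ n) = ⊤ →
      ∫⁻ ω, ENNReal.ofReal (f (X₁ ω, X₂ ω)) ∂P = ⊤ := fun {f} hf n hn ↦ by
    rw [← lintegral_map (f := fun x ↦ ENNReal.ofReal (f x)) (by fun_prop) hXm, hlaw]
    exact lintegral_compoundPoisson_eq_top hlam n hn
  refine ⟨fun α₁ α₂ _ _ hα ↦ ?_, ?_, ?_, ?_⟩
  · rw [hν, lintegral_smul_measure, hμ, lintegral_map (by fun_prop) hWm]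
    refine ENNReal.mul_lt_top ENNReal.ofReal_lt_top ?_
    simp only [hV, abs_inv, abs_abs]
    rw [lintegral_of_map_eq_cauchy hC hCauchy (g := fun x ↦ |x| ^ α₁ * |x|⁻¹ ^ α₂) (by fun_prop)]
    exact lintegral_cauchy_rpow_lt_top hα
  · refine hX (f := fun x ↦ |x.1 * x.2|) (by fun_prop) 2 ?_
    rw [convPow_two, Measure.lintegral_conv (by fun_prop), hμ, lintegral_map (by fun_prop) hWm]
    have hle : ∀ ω, ENNReal.ofReal (V ω) * ⊤ ≤
        ∫⁻ y, ENNReal.ofReal |((V ω, (V ω)⁻¹) + y).1 * ((V ω, (V ω)⁻¹) + y).2|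
          ∂(P.map fun ω ↦ (V ω, (V ω)⁻¹)) := fun ω ↦ by
      rw [lintegral_map (by fun_prop) hWm, ← hEVinv, ← lintegral_const_mul _ (by fun_prop)]
      refine lintegral_mono fun ω' ↦ ?_
      rw [← ENNReal.ofReal_mul (hV0 ω)]
      refine ENNReal.ofReal_le_ofReal (le_trans ?_ (le_abs_self _))
      have h1 := hV0 ω
      have h2 := hV0 ω'
      exact mul_le_mul (le_add_of_nonneg_right h2) (le_add_of_nonneg_left (inv_nonneg.2 h1))
        (inv_nonneg.2 h2) (add_nonneg h1 h2)
    refine eq_top_mono (lintegral_mono hle) ?_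
    rw [lintegral_mul_const _ (by fun_prop), hEV, ENNReal.top_mul_top]
  · refine hX (f := fun x ↦ |x.1|) (by fun_prop) 1 ?_
    rw [convPow_one, hμ, lintegral_map (by fun_prop) hWm]
    simpa only [abs_of_nonneg (hV0 _)] using hEV
  · refine hX (f := fun x ↦ |x.2|) (by fun_prop) 1 ?_
    rw [convPow_one, hμ, lintegral_map (by fun_prop) hWm]
    simpa only [abs_of_nonneg (inv_nonneg.2 (hV0 _))] using hEVinv
end

section
/- (Example 4A) Let V and V* be independent random variables such that E(|V|) = ∞ and V* is {0,1}-valued with P(V* = 1) = q ∈ (0,1). Define X₁ = V·V* and X₂ = V·(1 − V*). Then P(X₁ = 0) < 1, P(X₂ = 0) < 1, P(X₁ X₂ = 0) = 1 (so that E(|X₁X₂|) = 0 < ∞), E(|X₁|) = E(|X₂|) = ∞, and the random vector (X₁, X₂) is not infinitely divisible. -/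
open MeasureTheory ProbabilityTheory

/-- A probability distribution `μ` on an additive commutative monoid is infinitely
divisible if for every `n ≥ 1` it is the `n`-fold convolution of some probability
distribution with itself, i.e. the law of the sum of `n` i.i.d. copies. -/
def IsInfinitelyDivisible {E : Type*} [MeasurableSpace E] [AddCommMonoid E]
    (μ : Measure E) : Prop :=
  ∀ n : ℕ, 0 < n → ∃ ρ : Measure E, IsProbabilityMeasure ρ ∧
    μ = Measure.map (fun x : Fin n → E => ∑ i, x i) (Measure.pi fun _ => ρ)

open scoped Topology

/-- If the sum of two independent samples of `ρ` almost surely lies in a closed set, then so does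
the sum of any two points of the topological support of `ρ`. -/
theorem add_mem_of_mem_support {E : Type*} [TopologicalSpace E] [MeasurableSpace E]
    [AddCommMonoid E] [ContinuousAdd E] {ρ : Measure E} [SigmaFinite ρ] {A : Set E}
    (hA : IsClosed A) (h : ∀ᵐ x ∂(Measure.pi fun _ : Fin 2 => ρ), x 0 + x 1 ∈ A) {a b : E}
    (ha : a ∈ ρ.support) (hb : b ∈ ρ.support) : a + b ∈ A := by
  by_contra hab
  have hnhds : {p : E × E | p.1 + p.2 ∈ Aᶜ} ∈ 𝓝 (a, b) :=
    (hA.isOpen_compl.preimage continuous_add).mem_nhds hab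
  obtain ⟨s, hs, t, ht, hst⟩ := mem_nhds_prod_iff.mp hnhds
  have hs0 := (Measure.mem_support_iff_forall a).mp ha s hs
  have ht0 := (Measure.mem_support_iff_forall b).mp hb t ht
  have hnull : (Measure.pi fun _ : Fin 2 => ρ) (Set.univ.pi ![s, t]) = 0 := by
    refine measure_mono_null (fun x hx => ?_) (ae_iff.mp h)
    exact hst (Set.mk_mem_prod (hx 0 trivial) (hx 1 trivial))
  rw [Measure.pi_pi] at hnull
  simp [hs0.ne', ht0.ne'] at hnull

/-- An infinitely divisible law on the plane carried by the union of the two coordinate axes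
is carried by one of them. -/
theorem IsInfinitelyDivisible.ae_fst_eq_zero_or_ae_snd_eq_zero {μ : Measure (ℝ × ℝ)}
    (hμ : IsInfinitelyDivisible μ) (h : ∀ᵐ p ∂μ, p.1 * p.2 = 0) :
    (∀ᵐ p ∂μ, p.1 = 0) ∨ (∀ᵐ p ∂μ, p.2 = 0) := by
  obtain ⟨ρ, hρ, rfl⟩ := hμ 2 two_pos
  have hsum : Measurable fun x : Fin 2 → ℝ × ℝ => ∑ i, x i := by fun_prop
  have hA : IsClosed {p : ℝ × ℝ | p.1 * p.2 = 0} := isClosed_eq (by fun_prop) (by fun_prop)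
  have hadd : ∀ᵐ x ∂(Measure.pi fun _ : Fin 2 => ρ), x 0 + x 1 ∈ {p : ℝ × ℝ | p.1 * p.2 = 0} := by
    simpa [Fin.sum_univ_two] using ae_of_ae_map hsum.aemeasurable h
  have hmem {a b : ℝ × ℝ} (ha : a ∈ ρ.support) (hb : b ∈ ρ.support) :
      (a.1 + b.1) * (a.2 + b.2) = 0 := add_mem_of_mem_support hA hadd ha hb
  have hsupp : ∀ᵐ p ∂ρ, p ∈ ρ.support := Measure.support_mem_ae
  have hpi {f : ℝ × ℝ → ℝ} (hf : Measurable f) (hf_add : ∀ p q, f (p + q) = f p + f q)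
      (h0 : ∀ p ∈ ρ.support, f p = 0) :
      ∀ᵐ p ∂((Measure.pi fun _ : Fin 2 => ρ).map fun x => ∑ i, x i), f p = 0 := by
    rw [ae_map_iff hsum.aemeasurable (measurableSet_eq_fun hf measurable_const)]
    filter_upwards [Measure.tendsto_eval_ae_ae (μ := fun _ : Fin 2 => ρ) (i := 0) hsupp,
      Measure.tendsto_eval_ae_ae (μ := fun _ : Fin 2 => ρ) (i := 1) hsupp] with x hx0 hx1
    rw [Fin.sum_univ_two, hf_add, h0 _ hx0, h0 _ hx1, add_zero]
  by_cases hfst : ∀ p ∈ ρ.support, p.1 = 0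
  · exact Or.inl (hpi measurable_fst (fun _ _ => rfl) hfst)
  · refine Or.inr (hpi measurable_snd (fun _ _ => rfl) fun b hb => ?_)
    push Not at hfst
    obtain ⟨a, ha, ha1⟩ := hfst
    have haa := hmem ha ha
    have hbb := hmem hb hb
    have hab := hmem ha hb
    have ha2 : a.2 = 0 := by
      rcases mul_eq_zero.mp haa with h | h
      · exact absurd (by linarith) ha1
      · linarith
    by_contra hb2
    have hb1 : b.1 = 0 := by
      rcases mul_eq_zero.mp hbb with h | h
      · linarith
      · exact absurd (by linarith) hb2
    simp [ha2, hb1, ha1, hb2] at hab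

/-- The product of a non-integrable variable with an independent variable that is not almost
surely zero is not integrable. -/
theorem lintegral_abs_mul_eq_top_of_indepFun {Ω : Type*} [MeasurableSpace Ω] {P : Measure Ω}
    {V W : Ω → ℝ} (hV : Measurable V) (hW : Measurable W) (hVW : IndepFun V W P)
    (hEV : ∫⁻ ω, ENNReal.ofReal |V ω| ∂P = ⊤) (hW0 : ¬ ∀ᵐ ω ∂P, W ω = 0) :
    ∫⁻ ω, ENNReal.ofReal |V ω * W ω| ∂P = ⊤ := by
  have habs : Measurable fun x : ℝ => ENNReal.ofReal |x| := by fun_prop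
  have hEW : ∫⁻ ω, ENNReal.ofReal |W ω| ∂P ≠ 0 := by
    rw [Ne, lintegral_eq_zero_iff (by fun_prop)]
    refine fun h => hW0 (h.mono fun ω hω => ?_)
    simpa using hω
  simp_rw [abs_mul, ENNReal.ofReal_mul (abs_nonneg _)]
  have hmul : ∫⁻ ω, ENNReal.ofReal |V ω| * ENNReal.ofReal |W ω| ∂P =
      (∫⁻ ω, ENNReal.ofReal |V ω| ∂P) * ∫⁻ ω, ENNReal.ofReal |W ω| ∂P :=
    lintegral_mul_eq_lintegral_mul_lintegral_of_indepFun (habs.comp hV) (habs.comp hW)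
      (hVW.comp habs habs)
  rw [hmul, hEV, ENNReal.top_mul hEW]

/-- A variable with infinite absolute first moment is not almost surely zero. -/
theorem not_ae_eq_zero_of_lintegral_abs_eq_top {Ω : Type*} [MeasurableSpace Ω] {P : Measure Ω}
    {X : Ω → ℝ} (h : ∫⁻ ω, ENNReal.ofReal |X ω| ∂P = ⊤) : ¬ ∀ᵐ ω ∂P, X ω = 0 := by
  intro h0
  have : ∫⁻ ω, ENNReal.ofReal |X ω| ∂P = ∫⁻ _, 0 ∂P :=
    lintegral_congr_ae (h0.mono fun ω hω => by simp [hω])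
  simp [h] at this

/-- **Example 4A.** Let `V, V*` be independent, `E|V| = ∞`, `V*` Bernoulli on `{0,1}` with
`P(V* = 1) = q ∈ (0,1)`; put `X₁ = V·V*` and `X₂ = V·(1−V*)`.  Then `P(X₁=0) < 1`,
`P(X₂=0) < 1`, `P(X₁X₂=0) = 1` (hence `E|X₁X₂| = 0 < ∞`), `E|X₁| = E|X₂| = ∞`, and
`(X₁,X₂)` is not infinitely divisible. -/
theorem example4A_not_infinitely_divisible
    {Ω : Type*} [MeasurableSpace Ω] (P : Measure Ω) [IsProbabilityMeasure P]
    (V Vstar : Ω → ℝ) (hV : Measurable V) (hVstar : Measurable Vstar)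
    (hindep : IndepFun V Vstar P)
    (hEV : ∫⁻ ω, ENNReal.ofReal |V ω| ∂P = ⊤)
    (hval : ∀ ω, Vstar ω = 0 ∨ Vstar ω = 1)
    (q : ℝ) (hq : q ∈ Set.Ioo (0:ℝ) 1)
    (hPq : P {ω | Vstar ω = 1} = ENNReal.ofReal q)
    (X₁ X₂ : Ω → ℝ)
    (hX₁ : X₁ = fun ω => V ω * Vstar ω)
    (hX₂ : X₂ = fun ω => V ω * (1 - Vstar ω)) :
    P {ω | X₁ ω = 0} < 1 ∧
    P {ω | X₂ ω = 0} < 1 ∧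
    P {ω | X₁ ω * X₂ ω = 0} = 1 ∧
    (∫⁻ ω, ENNReal.ofReal |X₁ ω * X₂ ω| ∂P = 0) ∧
    (∫⁻ ω, ENNReal.ofReal |X₁ ω| ∂P = ⊤) ∧
    (∫⁻ ω, ENNReal.ofReal |X₂ ω| ∂P = ⊤) ∧
    ¬ IsInfinitelyDivisible (P.map fun ω => (X₁ ω, X₂ ω)) := by
  have hX₁m : Measurable X₁ := by rw [hX₁]; fun_prop
  have hX₂m : Measurable X₂ := by rw [hX₂]; fun_prop
  have hmul : ∀ ω, X₁ ω * X₂ ω = 0 := fun ω => by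
    rcases hval ω with h | h <;> simp [hX₁, hX₂, h]
  have hstar0 : ¬ ∀ᵐ ω ∂P, Vstar ω = 0 := fun h => by
    have hnull : P {ω | Vstar ω = 1} = 0 :=
      measure_mono_null (fun ω (hω : Vstar ω = 1) => by simp [hω]) (ae_iff.mp h)
    rw [hPq, ENNReal.ofReal_eq_zero] at hnull
    exact hq.1.not_ge hnull
  have hstar1 : ¬ ∀ᵐ ω ∂P, 1 - Vstar ω = 0 := fun h => by
    have hone : P {ω | Vstar ω = 1} = 1 :=
      (mem_ae_iff_prob_eq_one (hVstar (measurableSet_singleton 1))).mp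
        (h.mono fun ω hω => (sub_eq_zero.mp hω).symm)
    rw [hPq, ENNReal.ofReal_eq_one] at hone
    exact hq.2.ne hone
  have hE₁ : ∫⁻ ω, ENNReal.ofReal |X₁ ω| ∂P = ⊤ := by
    rw [hX₁]
    exact lintegral_abs_mul_eq_top_of_indepFun hV hVstar hindep hEV hstar0
  have hE₂ : ∫⁻ ω, ENNReal.ofReal |X₂ ω| ∂P = ⊤ := by
    rw [hX₂]
    exact lintegral_abs_mul_eq_top_of_indepFun hV (hVstar.const_sub 1)
      (hindep.comp measurable_id (measurable_id.const_sub 1)) hEV hstar1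
  have hX₁0 := not_ae_eq_zero_of_lintegral_abs_eq_top hE₁
  have hX₂0 := not_ae_eq_zero_of_lintegral_abs_eq_top hE₂
  have hlt {X : Ω → ℝ} (hX : Measurable X) (h0 : ¬ ∀ᵐ ω ∂P, X ω = 0) :
      P {ω | X ω = 0} < 1 :=
    prob_le_one.lt_of_ne fun h =>
      h0 ((mem_ae_iff_prob_eq_one (hX (measurableSet_singleton 0))).mpr h)
  refine ⟨hlt hX₁m hX₁0, hlt hX₂m hX₂0, by simp [hmul], by simp [hmul], hE₁, hE₂, fun hdiv => ?_⟩
  have hpair : AEMeasurable (fun ω => (X₁ ω, X₂ ω)) P := (hX₁m.prodMk hX₂m).aemeasurable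
  have haxes : ∀ᵐ p ∂(P.map fun ω => (X₁ ω, X₂ ω)), p.1 * p.2 = 0 := by
    rw [ae_map_iff hpair (measurableSet_eq_fun (by fun_prop) (by fun_prop))]
    exact ae_of_all _ hmul
  rcases hdiv.ae_fst_eq_zero_or_ae_snd_eq_zero haxes with h | h
  · exact hX₁0 (ae_of_ae_map hpair h)
  · exact hX₂0 (ae_of_ae_map hpair h)
end

section
/- (Remark 3(ii)) Let U and W be nonnegative, nondegenerate random variables and let c ≥ 0 be a constant such that P(UW = c) = 1. Then the distribution of the random vector (U, W) on ℝ² is indecomposable; in particular, it is not infinitely divisible. -/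
open MeasureTheory ProbabilityTheory

/-- A distribution is degenerate if it is a one-point mass. -/
def IsDegenerate {E : Type*} [MeasurableSpace E] (μ : Measure E) : Prop :=
  ∃ x : E, μ = Measure.dirac x

/-- A probability distribution `μ` is decomposable if it is the convolution of two
nondegenerate probability distributions; otherwise it is indecomposable. -/
def Decomposable {E : Type*} [MeasurableSpace E] [AddMonoid E] (μ : Measure E) : Prop :=
  ∃ μ₁ μ₂ : Measure E, IsProbabilityMeasure μ₁ ∧ IsProbabilityMeasure μ₂ ∧
    ¬ IsDegenerate μ₁ ∧ ¬ IsDegenerate μ₂ ∧ μ = μ₁.conv μ₂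

/-- The distribution of an almost surely constant random variable is degenerate. -/
theorem isDegenerate_map_of_ae_eq {Ω E : Type*} [MeasurableSpace Ω] [MeasurableSpace E]
    {P : Measure Ω} [IsProbabilityMeasure P] {X : Ω → E} {a : E} (h : ∀ᵐ ω ∂P, X ω = a) :
    IsDegenerate (P.map X) := by
  refine ⟨a, ?_⟩
  rw [Measure.map_congr (g := fun _ => a) h, Measure.map_const]
  simp

/-- The support of a nondegenerate distribution has at least two points. -/
theorem nontrivial_support_of_not_isDegenerate {E : Type*} [MeasurableSpace E]
    [TopologicalSpace E] [HereditarilyLindelofSpace E] {μ : Measure E} [IsProbabilityMeasure μ]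
    (h : ¬ IsDegenerate μ) : μ.support.Nontrivial := by
  by_contra hn
  rw [Set.not_nontrivial_iff] at hn
  obtain ⟨a, ha⟩ := Measure.nonempty_support (IsProbabilityMeasure.ne_zero μ)
  have hae : ∀ᵐ x ∂μ, id x = a := by
    filter_upwards [Measure.support_mem_ae (μ := μ)] with x hx using hn hx ha
  exact h (by simpa using isDegenerate_map_of_ae_eq hae)

/-- If a convolution is concentrated on a closed set, that set contains the sum of the supports. -/
theorem add_mem_of_mem_support_of_ae_conv {E : Type*} [MeasurableSpace E] [TopologicalSpace E]
    [AddMonoid E] [ContinuousAdd E] [MeasurableAdd₂ E] {μ ν : Measure E} [SFinite μ] [SFinite ν]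
    {s : Set E} (hs : IsClosed s) (h : ∀ᵐ z ∂(μ.conv ν), z ∈ s) {x y : E}
    (hx : x ∈ μ.support) (hy : y ∈ ν.support) : x + y ∈ s := by
  by_contra hxy
  have hnhds : (fun p : E × E => p.1 + p.2) ⁻¹' sᶜ ∈ nhds (x, y) :=
    (hs.isOpen_compl.preimage continuous_add).mem_nhds hxy
  obtain ⟨u, hu, v, hv, huv⟩ := mem_nhds_prod_iff.mp hnhds
  have hzero : (μ.prod ν) ((fun p : E × E => p.1 + p.2) ⁻¹' sᶜ) = 0 :=
    ae_of_ae_map measurable_add.aemeasurable h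
  have huv0 : μ u * ν v = 0 := by
    rw [← Measure.prod_prod]
    exact measure_mono_null huv hzero
  rcases mul_eq_zero.mp huv0 with h0 | h0
  · exact ((Measure.mem_support_iff_forall x).mp hx u hu).ne' h0
  · exact ((Measure.mem_support_iff_forall y).mp hy v hv).ne' h0

/-- The part of the hyperbola (or pair of axes) `u * w = c` in the closed first quadrant. -/
def quadrantHyperbola (c : ℝ) : Set (ℝ × ℝ) := {p | 0 ≤ p.1 ∧ 0 ≤ p.2 ∧ p.1 * p.2 = c}

theorem isClosed_quadrantHyperbola (c : ℝ) : IsClosed (quadrantHyperbola c) :=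
  (isClosed_le continuous_const continuous_fst).inter
    ((isClosed_le continuous_const continuous_snd).inter
      (isClosed_eq (continuous_fst.mul continuous_snd) continuous_const))

/-- A parallelogram with vertices on a hyperbola branch `u * w = c` in the closed first quadrant
has both sides parallel to the same axis. -/
theorem sides_parallel_to_axis_of_mem_quadrantHyperbola {c : ℝ} {p d e : ℝ × ℝ}
    (hp : p ∈ quadrantHyperbola c) (hd : p + d ∈ quadrantHyperbola c)
    (he : p + e ∈ quadrantHyperbola c) (hde : p + d + e ∈ quadrantHyperbola c)
    (hd0 : d ≠ 0) (he0 : e ≠ 0) : (d.1 = 0 ∧ e.1 = 0) ∨ (d.2 = 0 ∧ e.2 = 0) := by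
  obtain ⟨u, w⟩ := p
  obtain ⟨d₁, d₂⟩ := d
  obtain ⟨e₁, e₂⟩ := e
  simp only [quadrantHyperbola, Set.mem_ofPred_eq, Prod.mk_add_mk, ne_eq, Prod.mk_eq_zero,
    not_and] at *
  obtain ⟨hu, hw, hc⟩ := hp
  obtain ⟨hu₁, hw₁, hc₁⟩ := hd
  obtain ⟨hu₂, hw₂, hc₂⟩ := he
  obtain ⟨hu₃, hw₃, hc₃⟩ := hde
  have hcross : d₁ * e₂ + d₂ * e₁ = 0 := by linear_combination hc₃ - hc₁ - hc₂ + hc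
  by_cases hd₁ : d₁ = 0
  · subst hd₁
    have : d₂ * e₁ = 0 := by linear_combination hcross
    exact .inl ⟨rfl, (mul_eq_zero.mp this).resolve_left (hd0 rfl)⟩
  by_cases hd₂ : d₂ = 0
  · subst hd₂
    have : d₁ * e₂ = 0 := by linear_combination hcross
    exact .inr ⟨rfl, (mul_eq_zero.mp this).resolve_left hd₁⟩
  exfalso
  obtain ⟨t, rfl⟩ : ∃ t, e₁ = t * d₁ := ⟨e₁ / d₁, by field_simp⟩
  obtain rfl : e₂ = -(t * d₂) := mul_left_cancel₀ hd₁ (by linear_combination hcross)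
  have ht : t ≠ 0 := by
    rintro rfl
    simp at he0
  have hsum : u * d₂ + w * d₁ + d₁ * d₂ = 0 := by linear_combination hc₁ - hc
  have hdiff : -(u * d₂) + w * d₁ - t * (d₁ * d₂) = 0 :=
    mul_left_cancel₀ ht (by linear_combination hc₂ - hc)
  obtain rfl : w = (t - 1) * d₂ / 2 :=
    mul_left_cancel₀ hd₁ (by linear_combination (hsum + hdiff) / 2)
  obtain rfl : u = -(1 + t) * d₁ / 2 :=
    mul_left_cancel₀ hd₂ (by linear_combination (hsum - hdiff) / 2)
  have hzero : (t + 1) * d₂ = 0 := by linarith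
  obtain rfl : t = -1 := by
    have := (mul_eq_zero.mp hzero).resolve_right hd₂
    linarith
  exact hd₂ (by linarith)

/-- If two points of the hyperbola differ by a nonzero horizontal vector, they lie on the first
axis. -/
theorem snd_eq_zero_of_mem_quadrantHyperbola {c : ℝ} {p q : ℝ × ℝ}
    (hp : p ∈ quadrantHyperbola c) (hq : q ∈ quadrantHyperbola c)
    (hne : p.1 ≠ q.1) (heq : p.2 = q.2) : p.2 = 0 := by
  have h : (p.1 - q.1) * p.2 = 0 := by
    linear_combination hp.2.2 - hq.2.2 - q.1 * heq
  exact (mul_eq_zero.mp h).resolve_left (sub_ne_zero.mpr hne)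

theorem swap_mem_quadrantHyperbola {c : ℝ} {p : ℝ × ℝ} (hp : p ∈ quadrantHyperbola c) :
    p.swap ∈ quadrantHyperbola c :=
  ⟨hp.2.1, hp.1, (mul_comm _ _).trans hp.2.2⟩

/-- If two points of the hyperbola differ by a nonzero vertical vector, they lie on the second
axis. -/
theorem fst_eq_zero_of_mem_quadrantHyperbola {c : ℝ} {p q : ℝ × ℝ}
    (hp : p ∈ quadrantHyperbola c) (hq : q ∈ quadrantHyperbola c)
    (hne : p.2 ≠ q.2) (heq : p.1 = q.1) : p.1 = 0 :=
  snd_eq_zero_of_mem_quadrantHyperbola (swap_mem_quadrantHyperbola hp)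
    (swap_mem_quadrantHyperbola hq) hne heq

/-- If a sum of two nontrivial sets lies on the hyperbola, it lies on one of the axes. -/
theorem sum_subset_axis_of_subset_quadrantHyperbola {c : ℝ} {A B : Set (ℝ × ℝ)}
    (hA : A.Nontrivial) (hB : B.Nontrivial)
    (h : ∀ x ∈ A, ∀ y ∈ B, x + y ∈ quadrantHyperbola c) :
    (∀ x ∈ A, ∀ y ∈ B, (x + y).1 = 0) ∨ (∀ x ∈ A, ∀ y ∈ B, (x + y).2 = 0) := by
  obtain ⟨a, ha, a', ha', haa⟩ := hA
  obtain ⟨b, hb, b', hb', hbb⟩ := hB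
  have hpar := sides_parallel_to_axis_of_mem_quadrantHyperbola (p := a + b) (d := a' - a)
    (e := b' - b) (h a ha b hb) (by convert h a' ha' b hb using 1; abel)
    (by convert h a ha b' hb' using 1; abel) (by convert h a' ha' b' hb' using 1; abel)
    (sub_ne_zero.mpr haa.symm) (sub_ne_zero.mpr hbb.symm)
  simp only [Prod.fst_sub, Prod.snd_sub, sub_eq_zero] at hpar
  rcases hpar with ⟨h₁, h₂⟩ | ⟨h₁, h₂⟩
  · left
    have haa₂ : a.2 ≠ a'.2 := fun hh => haa (Prod.ext h₁.symm hh)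
    have hbb₂ : b.2 ≠ b'.2 := fun hh => hbb (Prod.ext h₂.symm hh)
    intro x hx y hy
    have hay := fst_eq_zero_of_mem_quadrantHyperbola (h a ha y hy) (h a' ha' y hy)
      (by simpa using haa₂) (by simp [h₁])
    have hxb := fst_eq_zero_of_mem_quadrantHyperbola (h x hx b hb) (h x hx b' hb')
      (by simpa using hbb₂) (by simp [h₂])
    have hab := fst_eq_zero_of_mem_quadrantHyperbola (h a ha b hb) (h a ha b' hb')
      (by simpa using hbb₂) (by simp [h₂])
    simp only [Prod.fst_add] at *
    linarith
  · right
    have haa₁ : a.1 ≠ a'.1 := fun hh => haa (Prod.ext hh h₁.symm)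
    have hbb₁ : b.1 ≠ b'.1 := fun hh => hbb (Prod.ext hh h₂.symm)
    intro x hx y hy
    have hay := snd_eq_zero_of_mem_quadrantHyperbola (h a ha y hy) (h a' ha' y hy)
      (by simpa using haa₁) (by simp [h₁])
    have hxb := snd_eq_zero_of_mem_quadrantHyperbola (h x hx b hb) (h x hx b' hb')
      (by simpa using hbb₁) (by simp [h₂])
    have hab := snd_eq_zero_of_mem_quadrantHyperbola (h a ha b hb) (h a ha b' hb')
      (by simpa using hbb₁) (by simp [h₂])
    simp only [Prod.snd_add] at *
    linarith

/-- A property of all sums of points of the supports holds almost surely for the convolution. -/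
theorem ae_conv_of_forall_mem_support {E : Type*} [MeasurableSpace E] [TopologicalSpace E]
    [HereditarilyLindelofSpace E] [AddMonoid E] [MeasurableAdd₂ E] {μ ν : Measure E}
    [SFinite μ] [SFinite ν] {p : E → Prop} (hp : MeasurableSet {z | p z})
    (h : ∀ x ∈ μ.support, ∀ y ∈ ν.support, p (x + y)) : ∀ᵐ z ∂(μ.conv ν), p z := by
  rw [Measure.conv, ae_map_iff measurable_add.aemeasurable hp]
  refine (Measure.ae_prod_iff_ae_ae (p := fun q : E × E => p (q.1 + q.2))
    (measurable_add hp)).mpr ?_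
  filter_upwards [Measure.support_mem_ae (μ := μ)] with x hx
  filter_upwards [Measure.support_mem_ae (μ := ν)] with y hy using h x hx y hy

/-- A nondegenerate infinitely divisible distribution is decomposable. -/
theorem IsInfinitelyDivisible.decomposable {E : Type*} [MeasurableSpace E] [AddCommMonoid E]
    [MeasurableAdd₂ E] {μ : Measure E} (h : IsInfinitelyDivisible μ) (hμ : ¬ IsDegenerate μ) :
    Decomposable μ := by
  obtain ⟨ρ, hρ, rfl⟩ := h 2 two_pos
  have hconv : Measure.map (fun x : Fin 2 → E => ∑ i, x i) (Measure.pi fun _ => ρ)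
      = ρ.conv ρ := by
    rw [Measure.conv, ← (measurePreserving_finTwoArrow ρ).map_eq,
      Measure.map_map measurable_add (MeasurableEquiv.measurable _)]
    congr 1
    ext x
    simp [Fin.sum_univ_two]
  rw [hconv] at hμ ⊢
  have hρd : ¬ IsDegenerate ρ := by
    rintro ⟨x, rfl⟩
    exact hμ ⟨x + x, Measure.dirac_conv_dirac x x⟩
  exact ⟨ρ, ρ, hρ, hρ, hρd, hρd, rfl⟩

/-- **Remark 3(ii).** If `U, W` are nonnegative nondegenerate random variables with
`P(UW = c) = 1` for a constant `c ≥ 0`, then the distribution of `(U, W)` is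
indecomposable; in particular it is not infinitely divisible. -/
theorem indecomposable_of_nonneg_product_degenerate
    {Ω : Type*} [MeasurableSpace Ω] (P : Measure Ω) [IsProbabilityMeasure P]
    (U W : Ω → ℝ) (hU : Measurable U) (hW : Measurable W)
    (hUpos : ∀ ω, 0 ≤ U ω) (hWpos : ∀ ω, 0 ≤ W ω)
    (hUnd : ¬ IsDegenerate (P.map U)) (hWnd : ¬ IsDegenerate (P.map W))
    (c : ℝ) (hc : 0 ≤ c) (hprod : P {ω | U ω * W ω = c} = 1) :
    ¬ Decomposable (P.map fun ω => (U ω, W ω)) ∧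
    ¬ IsInfinitelyDivisible (P.map fun ω => (U ω, W ω)) := by
  have hUW : Measurable fun ω => (U ω, W ω) := hU.prodMk hW
  have hnd : ¬ IsDegenerate (P.map fun ω => (U ω, W ω)) := by
    rintro ⟨x, hx⟩
    refine hUnd ⟨x.1, ?_⟩
    have hfst := congrArg (Measure.map Prod.fst) hx
    rwa [Measure.map_map measurable_fst hUW, Measure.map_dirac' measurable_fst] at hfst
  have hindec : ¬ Decomposable (P.map fun ω => (U ω, W ω)) := by
    rintro ⟨μ, ν, hμ, hν, hμd, hνd, heq⟩
    have hcurve : ∀ᵐ z ∂(μ.conv ν), z ∈ quadrantHyperbola c := by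
      rw [← heq, ae_map_iff (p := (· ∈ quadrantHyperbola c)) hUW.aemeasurable
        (isClosed_quadrantHyperbola c).measurableSet]
      have hae : ∀ᵐ ω ∂P, U ω * W ω = c :=
        (prob_compl_eq_zero_iff (measurableSet_eq_fun (hU.mul hW) measurable_const)).mpr hprod
      filter_upwards [hae] with ω hω using ⟨hUpos ω, hWpos ω, hω⟩
    rcases sum_subset_axis_of_subset_quadrantHyperbola
      (nontrivial_support_of_not_isDegenerate hμd) (nontrivial_support_of_not_isDegenerate hνd)
      (fun x hx y hy => add_mem_of_mem_support_of_ae_conv (isClosed_quadrantHyperbola c)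
        hcurve hx hy) with h | h
    · have hae := ae_conv_of_forall_mem_support (p := fun z : ℝ × ℝ => z.1 = 0)
        (measurableSet_eq_fun measurable_fst measurable_const) h
      rw [← heq] at hae
      exact hUnd (isDegenerate_map_of_ae_eq (ae_of_ae_map hUW.aemeasurable hae))
    · have hae := ae_conv_of_forall_mem_support (p := fun z : ℝ × ℝ => z.2 = 0)
        (measurableSet_eq_fun measurable_snd measurable_const) h
      rw [← heq] at hae
      exact hWnd (isDegenerate_map_of_ae_eq (ae_of_ae_map hUW.aemeasurable hae))
  exact ⟨hindec, fun h => hindec (h.decomposable hnd)⟩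
end
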